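/- arXiv:1203.2813 — 2 statements merged into one kernel-verified Lean document; each statement's English description precedes it below -/
import Mathlib

section
/- Let K be an infinite compact subset of ℝ^d. Then the set of measures μ ∈ P(K) satisfying D̲_μ(1) = 0 and D̄_μ(1) ∈ [dim̄_{B,conv}(K), dim̄_{B,conv,max}(K)] is residual in P(K) (it contains a dense G_δ set). -/
open MeasureTheory Filter Metric Set Topology

noncomputable section

/-- `ℝ^d` with the Euclidean metric. -/
abbrev Euc (d : ℕ) : Type := EuclideanSpace ℝ (Fin d)

/-- The largest number of pairwise disjoint balls of radius `r` with centers in `E`. -/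
noncomputable def packingNumber {X : Type*} [MetricSpace X] (E : Set X) (r : ℝ) : ℕ :=
  sSup {n : ℕ | ∃ c : Fin n → X, (∀ i, c i ∈ E) ∧
    Pairwise fun i j => Disjoint (ball (c i) r) (ball (c j) r)}

/-- The smallest number of balls of radius `r` needed to cover `E`. -/
noncomputable def coveringNumber {X : Type*} [MetricSpace X] (E : Set X) (r : ℝ) : ℕ :=
  sInf {n : ℕ | ∃ c : Fin n → X, E ⊆ ⋃ i, ball (c i) r}

/-- Upper box (Minkowski) dimension. -/
noncomputable def upperBoxDim {X : Type*} [MetricSpace X] (E : Set X) : EReal :=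
  limsup (fun r : ℝ => ((Real.log (coveringNumber E r : ℝ) / (-Real.log r) : ℝ) : EReal))
    (𝓝[>] (0:ℝ))

/-- Lower box (Minkowski) dimension. -/
noncomputable def lowerBoxDim {X : Type*} [MetricSpace X] (E : Set X) : EReal :=
  liminf (fun r : ℝ => ((Real.log (coveringNumber E r : ℝ) / (-Real.log r) : ℝ) : EReal))
    (𝓝[>] (0:ℝ))

/-- Packing dimension, defined as the modified upper box dimension. -/
noncomputable def packingDim {X : Type*} [MetricSpace X] (E : Set X) : EReal :=
  ⨅ (F : ℕ → Set X) (_ : E ⊆ ⋃ n, F n), ⨆ n, upperBoxDim (F n)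

/-- The local uniform upper box dimension. -/
noncomputable def locUnifUpperBoxDim {X : Type*} [MetricSpace X] (K : Set X) : EReal :=
  ⨅ (N : ℕ) (_ : 1 ≤ N) (x : Fin N → X) (_ : ∀ i, x i ∈ K) (r₀ : ℝ) (_ : 0 < r₀),
    limsup (fun r : ℝ =>
      ((⨅ i : Fin N, Real.log (packingNumber (K ∩ ball (x i) r₀) r : ℝ) / (-Real.log r) : ℝ)
        : EReal)) (𝓝[>] (0:ℝ))

/-- The convex upper box dimension. -/
noncomputable def convUpperBoxDim {X : Type*} [MetricSpace X] (K : Set X) : EReal :=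
  ⨅ (N : ℕ) (_ : 1 ≤ N) (x : Fin N → X) (_ : ∀ i, x i ∈ K) (ρ : ℝ) (_ : 0 < ρ)
    (p : Fin N → ℝ) (_ : ∀ i, 0 < p i) (_ : ∑ i, p i = 1),
    limsup (fun r : ℝ =>
      (((∑ i, p i * Real.log (packingNumber (K ∩ ball (x i) ρ) r : ℝ)) / (-Real.log r) : ℝ)
        : EReal)) (𝓝[>] (0:ℝ))

/-- The maximal convex upper box dimension. -/
noncomputable def convUpperBoxDimMax {X : Type*} [MetricSpace X] (K : Set X) : EReal :=
  ⨆ (y : X) (_ : y ∈ K) (ρ : ℝ) (_ : 0 < ρ), convUpperBoxDim (K ∩ ball y ρ)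

/-- `I_μ(r,q)`, with the logarithmic convention at `q = 1`. -/
noncomputable def Iq {X : Type*} [MetricSpace X] [MeasurableSpace X]
    (μ : Measure X) (r q : ℝ) : ℝ :=
  if q = 1 then ∫ x, Real.log ((μ (ball x r)).toReal) ∂μ
  else ∫ x, ((μ (ball x r)).toReal) ^ (q - 1) ∂μ

/-- The quantity whose `liminf`/`limsup` as `r → 0⁺` gives the lower/upper `L^q`-dimensions. -/
noncomputable def Dq {X : Type*} [MetricSpace X] [MeasurableSpace X]
    (μ : Measure X) (r q : ℝ) : ℝ :=
  if q = 1 then Iq μ r 1 / Real.log r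
  else (1 / (q - 1)) * (Real.log (Iq μ r q) / Real.log r)

/-- The upper `L^q`-dimension of a measure. -/
noncomputable def upperDim {X : Type*} [MetricSpace X] [MeasurableSpace X]
    (μ : Measure X) (q : ℝ) : EReal :=
  limsup (fun r : ℝ => ((Dq μ r q : ℝ) : EReal)) (𝓝[>] (0:ℝ))

/-- The lower `L^q`-dimension of a measure. -/
noncomputable def lowerDim {X : Type*} [MetricSpace X] [MeasurableSpace X]
    (μ : Measure X) (q : ℝ) : EReal :=
  liminf (fun r : ℝ => ((Dq μ r q : ℝ) : EReal)) (𝓝[>] (0:ℝ))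

/-- The (topological) support of a measure. -/
noncomputable def msupport {X : Type*} [MetricSpace X] [MeasurableSpace X]
    (μ : Measure X) : Set X :=
  {x | ∀ r > (0:ℝ), 0 < μ (ball x r)}

/-- The upper `L^∞`-dimension of a measure. -/
noncomputable def upperDimInfty {X : Type*} [MetricSpace X] [MeasurableSpace X]
    (μ : Measure X) : EReal :=
  limsup (fun r : ℝ =>
    ((Real.log (⨆ x ∈ msupport μ, (μ (ball x r)).toReal) / Real.log r : ℝ) : EReal))
    (𝓝[>] (0:ℝ))

/-- The lower `L^∞`-dimension of a measure. -/
noncomputable def lowerDimInfty {X : Type*} [MetricSpace X] [MeasurableSpace X]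
    (μ : Measure X) : EReal :=
  liminf (fun r : ℝ =>
    ((Real.log (⨆ x ∈ msupport μ, (μ (ball x r)).toReal) / Real.log r : ℝ) : EReal))
    (𝓝[>] (0:ℝ))

/-- The upper `L^{-∞}`-dimension of a measure. -/
noncomputable def upperDimNegInfty {X : Type*} [MetricSpace X] [MeasurableSpace X]
    (μ : Measure X) : EReal :=
  limsup (fun r : ℝ =>
    ((Real.log (⨅ x ∈ msupport μ, (μ (ball x r)).toReal) / Real.log r : ℝ) : EReal))
    (𝓝[>] (0:ℝ))

/-- The lower `L^{-∞}`-dimension of a measure. -/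
noncomputable def lowerDimNegInfty {X : Type*} [MetricSpace X] [MeasurableSpace X]
    (μ : Measure X) : EReal :=
  liminf (fun r : ℝ =>
    ((Real.log (⨅ x ∈ msupport μ, (μ (ball x r)).toReal) / Real.log r : ℝ) : EReal))
    (𝓝[>] (0:ℝ))

/-- The half-closed dyadic cube of side `2^{-n}` indexed by `k`. -/
noncomputable def dyadicCube (d n : ℕ) (k : Fin d → ℤ) : Set (Euc d) :=
  {x | ∀ j, (k j : ℝ) / 2 ^ n ≤ x j ∧ x j < ((k j : ℝ) + 1) / 2 ^ n}

/-- `K_n`: the union of the half-closed dyadic cubes of side `2^{-n}` meeting `K`. -/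
noncomputable def dyadicHull (d : ℕ) (K : Set (Euc d)) (n : ℕ) : Set (Euc d) :=
  ⋃ (k : Fin d → ℤ) (_ : (dyadicCube d n k ∩ K).Nonempty), dyadicCube d n k

/-- The number of connected components of a set. -/
noncomputable def numComponents {X : Type*} [TopologicalSpace X] (S : Set X) : ℕ :=
  Nat.card {C : Set X // ∃ x ∈ S, C = connectedComponentIn S x}

/-- The box separation index `bsi(K)`. -/
noncomputable def bsi (d : ℕ) (K : Set (Euc d)) : ℝ :=
  liminf (fun n : ℕ =>
    Real.log (numComponents (dyadicHull d K n) : ℝ) / (n * Real.log 2)) atTop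

/-- The Fortet–Mourier distance between two measures. -/
noncomputable def FMdist {X : Type*} [MetricSpace X] [MeasurableSpace X]
    (μ ν : Measure X) : ℝ :=
  ⨆ f : {f : X → ℝ // LipschitzWith 1 f ∧ ∀ x, |f x| ≤ 1},
    |∫ x, f.1 x ∂μ - ∫ x, f.1 x ∂ν|

section TypicalMeasures

open scoped ENNReal

section LogEntropy

theorem neg_log_measure_nonneg {α : Type*} [MeasurableSpace α] (μ : Measure α)
    [IsProbabilityMeasure μ] (s : Set α) : 0 ≤ -Real.log (μ s).toReal := by
  have h : (μ s).toReal ≤ 1 :=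
    ENNReal.toReal_le_of_le_ofReal zero_le_one (by simpa using prob_le_one)
  have := Real.log_nonpos ENNReal.toReal_nonneg h
  linarith

variable {X : Type*} [MetricSpace X] [MeasurableSpace X]

/-- The nonnegative quantity `-I_μ(r,1)`, as a Lebesgue integral. -/
def logEnt (μ : Measure X) (r : ℝ) : ℝ≥0∞ :=
  ∫⁻ x, ENNReal.ofReal (-Real.log (μ (ball x r)).toReal) ∂μ

theorem measurable_measure_ball [SecondCountableTopology X] [BorelSpace X]
    (μ : Measure X) [SFinite μ] (r : ℝ) :
    Measurable fun x => μ (ball x r) := by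
  have hs : MeasurableSet {p : X × X | dist p.2 p.1 < r} :=
    measurableSet_lt (measurable_snd.dist measurable_fst) measurable_const
  exact measurable_measure_prodMk_left hs

theorem Iq_one_eq_neg_logEnt [SecondCountableTopology X] [BorelSpace X]
    (μ : Measure X) [IsProbabilityMeasure μ] (r : ℝ) :
    Iq μ r 1 = -(logEnt μ r).toReal := by
  have hm : Measurable fun x => -Real.log (μ (ball x r)).toReal :=
    ((measurable_measure_ball μ r).ennreal_toReal.log).neg
  have := integral_eq_lintegral_of_nonneg_ae (μ := μ)
    (f := fun x => -Real.log (μ (ball x r)).toReal)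
    (Eventually.of_forall fun x => neg_log_measure_nonneg μ _) hm.aestronglyMeasurable
  rw [logEnt, ← this, integral_neg, neg_neg]
  simp [Iq]

theorem Dq_one_eq_logEnt [SecondCountableTopology X] [BorelSpace X]
    (μ : Measure X) [IsProbabilityMeasure μ] (r : ℝ) :
    Dq μ r 1 = (logEnt μ r).toReal / (-Real.log r) := by
  rw [Dq, if_pos rfl, Iq_one_eq_neg_logEnt, neg_div, div_neg]

/-- On a set covered by `N` sets of diameter less than `r`, the contribution to `-I_μ(r,1)` is
controlled by `log N`. -/
theorem setLIntegral_neg_log_le [BorelSpace X] (μ : Measure X) [IsProbabilityMeasure μ]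
    {r : ℝ} {A : Set X} (hA : MeasurableSet A) {N : ℕ} (C : Fin N → Set X)
    (hC : ∀ i, MeasurableSet (C i)) (hAC : A ⊆ ⋃ i, C i)
    (hdiam : ∀ i, ∀ x ∈ C i, ∀ y ∈ C i, dist y x < r) :
    ∫⁻ x in A, ENNReal.ofReal (-Real.log (μ (ball x r)).toReal) ∂μ
      ≤ μ A * ENNReal.ofReal (Real.log N) + 1 := by
  have key : ∀ x ∈ A, ENNReal.ofReal (-Real.log (μ (ball x r)).toReal) ≤
      ENNReal.ofReal (Real.log N) +
        ∑ i, (C i).indicator (fun _ => ((N : ℝ≥0∞) * μ (C i))⁻¹) x := by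
    intro x hx
    obtain ⟨i, hi⟩ := mem_iUnion.1 (hAC hx)
    have hN : 0 < N := Fin.pos i
    have hN' : (0 : ℝ) < N := by exact_mod_cast hN
    have h1 : ((N : ℝ≥0∞) * μ (C i))⁻¹ ≤
        ∑ i, (C i).indicator (fun _ => ((N : ℝ≥0∞) * μ (C i))⁻¹) x := by
      have := Finset.single_le_sum (f := fun i => (C i).indicator
        (fun _ => ((N : ℝ≥0∞) * μ (C i))⁻¹) x) (fun _ _ => zero_le) (Finset.mem_univ i)
      simpa [indicator_of_mem hi] using this
    refine le_trans ?_ (add_le_add le_rfl h1)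
    by_cases h0 : μ (C i) = 0
    · simp [h0]
    have hsub : C i ⊆ ball x r := fun y hy => hdiam i x hi y hy
    have hm : 0 < (μ (C i)).toReal := ENNReal.toReal_pos h0 (measure_ne_top _ _)
    have hle : (μ (C i)).toReal ≤ (μ (ball x r)).toReal :=
      ENNReal.toReal_mono (measure_ne_top _ _) (measure_mono hsub)
    have hlog := Real.log_le_log hm hle
    have hq : ((N : ℝ≥0∞) * μ (C i))⁻¹ = ENNReal.ofReal ((N * (μ (C i)).toReal)⁻¹) := by
      rw [ENNReal.ofReal_inv_of_pos (by positivity), ENNReal.ofReal_mul (by positivity),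
        ENNReal.ofReal_toReal (measure_ne_top _ _), ENNReal.ofReal_natCast]
    rw [hq, ← ENNReal.ofReal_add (Real.log_natCast_nonneg _) (by positivity)]
    apply ENNReal.ofReal_le_ofReal
    have h2 := Real.log_le_sub_one_of_pos (x := (N * (μ (C i)).toReal)⁻¹) (by positivity)
    rw [Real.log_inv, Real.log_mul (by positivity) (by positivity)] at h2
    linarith
  calc ∫⁻ x in A, ENNReal.ofReal (-Real.log (μ (ball x r)).toReal) ∂μ
      ≤ ∫⁻ x in A, (ENNReal.ofReal (Real.log N) +
        ∑ i, (C i).indicator (fun _ => ((N : ℝ≥0∞) * μ (C i))⁻¹) x) ∂μ :=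
        setLIntegral_mono' hA key
    _ = μ A * ENNReal.ofReal (Real.log N) +
        ∑ i, ((N : ℝ≥0∞) * μ (C i))⁻¹ * μ (C i ∩ A) := by
        rw [lintegral_add_left measurable_const, lintegral_finsetSum _
          (fun i _ => measurable_const.indicator (hC i))]
        congr 1
        · simp [mul_comm]
        · refine Finset.sum_congr rfl fun i _ => ?_
          rw [lintegral_indicator_const (hC i), Measure.restrict_apply (hC i)]
    _ ≤ μ A * ENNReal.ofReal (Real.log N) + ∑ i : Fin N, (N : ℝ≥0∞)⁻¹ := by
        gcongr with i
        by_cases h0 : μ (C i) = 0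
        · rw [measure_mono_null inter_subset_left h0]; simp
        rw [ENNReal.mul_inv (Or.inr (measure_ne_top _ _)) (Or.inr h0), mul_assoc]
        calc (N : ℝ≥0∞)⁻¹ * ((μ (C i))⁻¹ * μ (C i ∩ A))
            ≤ (N : ℝ≥0∞)⁻¹ * ((μ (C i))⁻¹ * μ (C i)) := by gcongr; exact inter_subset_left
          _ = (N : ℝ≥0∞)⁻¹ := by rw [ENNReal.inv_mul_cancel h0 (measure_ne_top _ _), mul_one]
    _ ≤ _ := by
        gcongr
        simp only [Finset.sum_const, Finset.card_univ, Fintype.card_fin, nsmul_eq_mul]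
        exact ENNReal.mul_inv_le_one _

theorem lintegral_le_sum_of_cover {α ι : Type*} [MeasurableSpace α] {μ : Measure α} (Z : Finset ι)
    (A : ι → Set α) (R : Set α) (hcov : univ ⊆ (⋃ z ∈ Z, A z) ∪ R) (f : α → ℝ≥0∞) :
    ∫⁻ x, f x ∂μ ≤ (∑ z ∈ Z, ∫⁻ x in A z, f x ∂μ) + ∫⁻ x in R, f x ∂μ := by
  have h : ∫⁻ x, f x ∂μ ≤ ∫⁻ x in (⋃ z : Z, A z) ∪ R, f x ∂μ := by
    rw [← setLIntegral_univ]
    refine lintegral_mono_set (hcov.trans ?_)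
    simp [iUnion_subtype]
  refine h.trans ((lintegral_union_le f _ _).trans ?_)
  gcongr
  refine (lintegral_iUnion_le _ _).trans ?_
  rw [tsum_fintype, ← Finset.sum_coe_sort Z (fun z => ∫⁻ x in A z, f x ∂μ)]

/-- Lower bound for `-I_μ(r,1)` from finitely many disjoint sets on which balls have small mass. -/
theorem le_logEnt [SecondCountableTopology X] [BorelSpace X]
    (μ : Measure X) [IsProbabilityMeasure μ] {ι : Type*} [Fintype ι] {r : ℝ} (hr : 0 < r)
    (A : ι → Set X) (hA : ∀ i, MeasurableSet (A i)) (hd : Pairwise fun i j => Disjoint (A i) (A j))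
    (a b : ι → ℝ) (ha0 : ∀ i, 0 ≤ a i)
    (ha : ∀ i, ENNReal.ofReal (a i) ≤ μ (A i))
    (hb : ∀ i, ∀ x ∈ A i, μ (ball x r) ≤ ENNReal.ofReal (b i)) :
    ENNReal.ofReal (∑ i, a i * (-Real.log (b i))) ≤ logEnt μ r := by
  have hpos : ∀ᵐ x ∂μ, 0 < μ (ball x r) := by
    filter_upwards [Measure.support_mem_ae (μ := μ)] with x hx
    exact (Measure.mem_support_iff_forall x).1 hx _ (ball_mem_nhds x hr)
  calc ENNReal.ofReal (∑ i, a i * (-Real.log (b i)))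
      ≤ ∑ i, ENNReal.ofReal (a i * (-Real.log (b i))) := by
        apply ENNReal.ofReal_le_of_le_toReal
        rw [ENNReal.toReal_sum (fun i _ => ENNReal.ofReal_ne_top)]
        refine Finset.sum_le_sum fun i _ => ?_
        rw [ENNReal.toReal_ofReal']
        exact le_max_left _ _
    _ ≤ ∑ i, ∫⁻ x in A i, ENNReal.ofReal (-Real.log (μ (ball x r)).toReal) ∂μ := by
        refine Finset.sum_le_sum fun i _ => ?_
        rw [ENNReal.ofReal_mul (ha0 i)]
        calc ENNReal.ofReal (a i) * ENNReal.ofReal (-Real.log (b i))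
            ≤ μ (A i) * ENNReal.ofReal (-Real.log (b i)) := by gcongr; exact ha i
          _ = ∫⁻ x in A i, ENNReal.ofReal (-Real.log (b i)) ∂μ := by
              rw [setLIntegral_const, mul_comm]
          _ ≤ _ := by
              refine lintegral_mono_ae ?_
              filter_upwards [ae_restrict_of_ae hpos, ae_restrict_mem (hA i)] with x hx hxA
              apply ENNReal.ofReal_le_ofReal
              have hx' : 0 < (μ (ball x r)).toReal := ENNReal.toReal_pos hx.ne' (measure_ne_top _ _)
              have hbi : 0 ≤ b i := by
                by_contra hneg
                have := hb i x hxA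
                rw [ENNReal.ofReal_of_nonpos (le_of_not_ge hneg)] at this
                exact hx.ne' (le_antisymm this zero_le)
              have := Real.log_le_log hx' (ENNReal.toReal_le_of_le_ofReal hbi (hb i x hxA))
              linarith
    _ = ∫⁻ x in ⋃ i, A i, ENNReal.ofReal (-Real.log (μ (ball x r)).toReal) ∂μ := by
        rw [lintegral_iUnion hA hd, tsum_fintype]
    _ ≤ logEnt μ r := setLIntegral_le_lintegral _ _

end LogEntropy

section Atomic

variable {X : Type*} [MeasurableSpace X]

/-- The finitely supported measure `∑ k, q k • δ_{y k}`. -/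
def atomic {κ : Type*} [Fintype κ] (q : κ → ℝ) (y : κ → X) : Measure X :=
  ∑ k, ENNReal.ofReal (q k) • Measure.dirac (y k)

open Classical in
theorem atomic_apply {κ : Type*} [Fintype κ] {q : κ → ℝ} (hq : ∀ k, 0 ≤ q k) (y : κ → X)
    {s : Set X} (hs : MeasurableSet s) :
    atomic q y s = ENNReal.ofReal (∑ k with y k ∈ s, q k) := by
  rw [atomic, Measure.finsetSum_apply, ENNReal.ofReal_sum_of_nonneg fun k _ => hq k,
    Finset.sum_filter]
  refine Finset.sum_congr rfl fun k _ => ?_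
  rw [Measure.smul_apply, Measure.dirac_apply' _ hs, smul_eq_mul]
  by_cases h : y k ∈ s <;> simp [h]

theorem atomic_apply_eq_zero {κ : Type*} [Fintype κ] {q : κ → ℝ} (hq : ∀ k, 0 ≤ q k) {y : κ → X}
    {s : Set X} (hs : MeasurableSet s) (h : ∀ k, y k ∉ s) : atomic q y s = 0 := by
  classical
  rw [atomic_apply hq y hs, Finset.filter_false_of_mem fun k _ => h k, Finset.sum_empty,
    ENNReal.ofReal_zero]

theorem isProbabilityMeasure_atomic {κ : Type*} [Fintype κ] {q : κ → ℝ} (hq : ∀ k, 0 ≤ q k)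
    (hq1 : ∑ k, q k = 1) (y : κ → X) : IsProbabilityMeasure (atomic q y) := by
  classical
  refine ⟨?_⟩
  rw [atomic_apply hq y MeasurableSet.univ]
  simp [hq1]

/-- `atomic` as a probability measure. -/
def atomicProb {κ : Type*} [Fintype κ] (q : κ → ℝ) (hq : ∀ k, 0 ≤ q k)
    (hq1 : ∑ k, q k = 1) (y : κ → X) : ProbabilityMeasure X :=
  ⟨atomic q y, isProbabilityMeasure_atomic hq hq1 y⟩

theorem atomic_sigma {ι : Type*} [Fintype ι] {κ : ι → Type*}
    [∀ i, Fintype (κ i)] {w : ∀ i, κ i → ℝ} (hw : ∀ i k, 0 ≤ w i k) {p : ι → ℝ}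
    (hp : ∀ i, ∑ k, w i k = p i) (x : ι → X) :
    atomic (fun s : Σ i, κ i => w s.1 s.2) (fun s => x s.1) = atomic p x := by
  unfold atomic
  rw [Fintype.sum_sigma]
  refine Finset.sum_congr rfl fun i _ => ?_
  rw [← hp i, ENNReal.ofReal_sum_of_nonneg fun k _ => hw i k, Finset.sum_smul]

end Atomic

section WeakTopology

variable {X : Type*} [MetricSpace X] [MeasurableSpace X] [BorelSpace X]

theorem isOpen_setOf_lt_measure {G : Set X} (hG : IsOpen G) (c : ℝ≥0∞) :
    IsOpen {μ : ProbabilityMeasure X | c < (μ : Measure X) G} := by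
  rw [isOpen_iff_mem_nhds]
  intro μ hμ
  have h := ProbabilityMeasure.le_liminf_measure_open_of_tendsto (μ := μ) tendsto_id hG
  exact eventually_lt_of_lt_liminf (lt_of_lt_of_le hμ h)

theorem isOpen_setOf_measure_lt {F : Set X} (hF : IsClosed F) (c : ℝ≥0∞) :
    IsOpen {μ : ProbabilityMeasure X | (μ : Measure X) F < c} := by
  rw [isOpen_iff_mem_nhds]
  intro μ hμ
  have h := ProbabilityMeasure.limsup_measure_closed_le_of_tendsto (μ := μ) tendsto_id hF
  exact eventually_lt_of_limsup_lt (lt_of_le_of_lt h hμ)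

/-- Moving mass by a small distance keeps a probability measure in a given open set. -/
theorem exists_forall_map_mem [SecondCountableTopology X] {O : Set (ProbabilityMeasure X)}
    (hO : IsOpen O) {ν : ProbabilityMeasure X} (hν : ν ∈ O) :
    ∃ ρ > 0, ∀ {Ω : Type*} [MeasurableSpace Ω] (P : ProbabilityMeasure Ω) (f g : Ω → X)
      (hf : Measurable f) (hg : Measurable g), P.map hf.aemeasurable = ν →
      (∀ ω, dist (g ω) (f ω) < ρ) → P.map hg.aemeasurable ∈ O := by
  have hpre := hO.preimage (LevyProkhorov.continuous_toMeasure_probabilityMeasure (Ω := X))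
  obtain ⟨ε, hε, hball⟩ := Metric.isOpen_iff.1 hpre (LevyProkhorov.ofMeasure ν) hν
  refine ⟨ε / 2, half_pos hε, fun {Ω} _ P f g hf hg hfν hdist => ?_⟩
  have : LevyProkhorov.ofMeasure (P.map hg.aemeasurable) ∈ ball (LevyProkhorov.ofMeasure ν) ε := by
    rw [mem_ball, LevyProkhorov.dist_probabilityMeasure_def]
    refine lt_of_le_of_lt ?_ (half_lt_self hε)
    refine levyProkhorovDist_le_of_forall_le _ _ (half_pos hε).le fun δ B hδ hB => ?_
    refine le_add_right ?_
    rw [← hfν]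
    simp only [ProbabilityMeasure.toMeasure_map]
    rw [Measure.map_apply hg hB, Measure.map_apply hf isOpen_thickening.measurableSet]
    refine measure_mono fun ω hω => ?_
    exact mem_thickening_iff.2 ⟨g ω, hω, by rw [dist_comm]; exact (hdist ω).trans hδ⟩
  exact hball this

theorem exists_forall_atomicProb_mem [SecondCountableTopology X] {O : Set (ProbabilityMeasure X)}
    (hO : IsOpen O) {ν : ProbabilityMeasure X} (hν : ν ∈ O) :
    ∃ ρ > 0, ∀ {κ : Type} [Fintype κ] (q : κ → ℝ) (hq : ∀ k, 0 ≤ q k)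
      (hq1 : ∑ k, q k = 1) (x y : κ → X), atomic q x = ν →
      (∀ k, dist (y k) (x k) < ρ) → atomicProb q hq hq1 y ∈ O := by
  obtain ⟨ρ, hρ, h⟩ := exists_forall_map_mem hO hν
  refine ⟨ρ, hρ, fun {κ} _ q hq hq1 x y hx hd => ?_⟩
  let : MetricSpace κ := MetricSpace.induced (fun k => (Fintype.equivFin κ k : ℝ))
    (fun a b hab => by simpa [Fin.val_inj] using hab) inferInstance
  let : MeasurableSpace κ := borel κ
  have : BorelSpace κ := ⟨rfl⟩
  have hmap : ∀ z : κ → X, Measurable z → (atomic q (id : κ → κ)).map z = atomic q z := by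
    intro z hz
    ext s hs
    rw [Measure.map_apply hz hs, atomic_apply hq _ (hz hs), atomic_apply hq _ hs]
    rfl
  have := h (atomicProb q hq hq1 (id : κ → κ)) x y (measurable_of_countable x)
    (measurable_of_countable y) (by
      apply ProbabilityMeasure.toMeasure_injective
      rw [ProbabilityMeasure.toMeasure_map, ← hx, ← hmap x (measurable_of_countable x)]
      rfl) hd
  convert this using 1
  apply ProbabilityMeasure.toMeasure_injective
  rw [ProbabilityMeasure.toMeasure_map]
  exact (hmap y (measurable_of_countable y)).symm

theorem exists_simpleFunc_dist_lt [CompactSpace X] [Nonempty X] {ρ : ℝ} (hρ : 0 < ρ) :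
    ∃ f : SimpleFunc X X, ∀ x, dist (f x) x < ρ := by
  have hdense := TopologicalSpace.denseRange_denseSeq X
  have hcov : (univ : Set X) ⊆ ⋃ k, ball (TopologicalSpace.denseSeq X k) ρ := by
    intro x _
    obtain ⟨k, hk⟩ := hdense.exists_dist_lt x hρ
    exact mem_iUnion.2 ⟨k, hk⟩
  obtain ⟨t, ht⟩ := isCompact_univ.elim_finite_subcover _ (fun k => isOpen_ball) hcov
  refine ⟨SimpleFunc.nearestPt (TopologicalSpace.denseSeq X) (t.sup id), fun x => ?_⟩
  obtain ⟨k, hk, hx⟩ := mem_iUnion₂.1 (ht (mem_univ x))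
  have hle := SimpleFunc.edist_nearestPt_le (TopologicalSpace.denseSeq X) x
    (Finset.le_sup (f := id) hk)
  rw [edist_dist, edist_dist, ENNReal.ofReal_le_ofReal_iff dist_nonneg] at hle
  exact hle.trans_lt (by rw [dist_comm]; exact hx)

theorem exists_eq_atomic (μ : Measure X) [IsProbabilityMeasure μ] {Z : Finset X}
    (hZ : μ (Z : Set X)ᶜ = 0) :
    ∃ (N : ℕ) (p : Fin N → ℝ) (x : Fin N → X), (∀ i, 0 < p i) ∧ ∑ i, p i = 1 ∧
      Function.Injective x ∧ atomic p x = μ := by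
  classical
  set W := Z.filter fun z => μ {z} ≠ 0 with hW
  have hs : ∀ s : Set X, MeasurableSet s → μ s = ∑ z ∈ W with z ∈ s, μ {z} := by
    intro s hs
    have h1 : μ s = μ (s ∩ Z) := by
      refine le_antisymm ?_ (measure_mono inter_subset_left)
      calc μ s ≤ μ ((s ∩ Z) ∪ (Z : Set X)ᶜ) := measure_mono fun x hx => by
            by_cases h : x ∈ (Z : Set X)
            · exact Or.inl ⟨hx, h⟩
            · exact Or.inr h
        _ ≤ _ := (measure_union_le _ _).trans (by rw [hZ, add_zero])
    have h2 : s ∩ Z = ((Z.filter (· ∈ s) : Finset X) : Set X) := by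
      ext x; simp [and_comm]
    rw [h1, h2, ← sum_measure_singleton, hW, Finset.filter_filter, Finset.sum_filter,
      Finset.sum_filter]
    refine Finset.sum_congr rfl fun z _ => ?_
    by_cases h : μ {z} = 0 <;> by_cases h' : z ∈ s <;> simp [h, h']
  have hEq : ∀ g : X → ℝ, ∑ i : Fin W.card, g (W.equivFin.symm i) = ∑ z ∈ W, g z := by
    intro g
    rw [← Finset.sum_coe_sort W g]
    exact Equiv.sum_comp W.equivFin.symm (fun z : W => g z)
  have hpos : ∀ i, 0 < (μ {(W.equivFin.symm i : X)}).toReal := fun i => by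
    have := (Finset.mem_filter.1 (W.equivFin.symm i).2).2
    exact ENNReal.toReal_pos this (measure_ne_top _ _)
  have hreal : ∀ s : Set X, MeasurableSet s →
      μ s = ENNReal.ofReal (∑ z ∈ W with z ∈ s, (μ {z}).toReal) := fun s hs' => by
    rw [hs s hs', ENNReal.ofReal_sum_of_nonneg fun _ _ => ENNReal.toReal_nonneg]
    exact Finset.sum_congr rfl fun z _ => (ENNReal.ofReal_toReal (measure_ne_top _ _)).symm
  refine ⟨W.card, fun i => (μ {(W.equivFin.symm i : X)}).toReal, fun i => W.equivFin.symm i,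
    hpos, ?_, Subtype.val_injective.comp W.equivFin.symm.injective, ?_⟩
  · rw [hEq fun z => (μ {z}).toReal]
    have := hreal univ MeasurableSet.univ
    rw [measure_univ] at this
    simpa using this.symm
  · ext s hs'
    rw [atomic_apply (fun i => (hpos i).le) _ hs', hreal s hs', Finset.sum_filter,
      Finset.sum_filter, hEq fun z => if z ∈ s then (μ {z}).toReal else 0]

/-- Measures with finitely many atoms are dense. -/
theorem exists_atomicProb_mem [CompactSpace X] {O : Set (ProbabilityMeasure X)}
    (hO : IsOpen O) (hne : O.Nonempty) :
    ∃ (N : ℕ) (p : Fin N → ℝ) (hp : ∀ i, 0 < p i) (hp1 : ∑ i, p i = 1) (x : Fin N → X),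
      Function.Injective x ∧ atomicProb p (fun i => (hp i).le) hp1 x ∈ O := by
  obtain ⟨μ, hμ⟩ := hne
  have := μ.nonempty
  obtain ⟨ρ, hρ, h⟩ := exists_forall_map_mem hO hμ
  obtain ⟨f, hf⟩ := exists_simpleFunc_dist_lt (X := X) hρ
  have hmem := h μ id f measurable_id f.measurable
    (by apply ProbabilityMeasure.toMeasure_injective; simp) hf
  set ν := μ.map f.measurable.aemeasurable with hν
  have hZ : (ν : Measure X) (f.range : Set X)ᶜ = 0 := by
    rw [hν, ProbabilityMeasure.toMeasure_map, Measure.map_apply f.measurable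
      (f.range.finite_toSet.measurableSet.compl)]
    convert! measure_empty
    · ext x; simp
    · infer_instance
  obtain ⟨N, p, x, hp, hp1, hx, hxν⟩ := exists_eq_atomic (ν : Measure X) hZ
  refine ⟨N, p, hp, hp1, x, hx, ?_⟩
  convert hmem using 1
  exact ProbabilityMeasure.toMeasure_injective hxν

end WeakTopology

section Packing

variable {d : ℕ}

theorem exists_packing_card_le {K : Set (Euc d)} (hK : Bornology.IsBounded K) :
    ∃ C : ℝ, 1 ≤ C ∧ ∀ r : ℝ, 0 < r → r < 1 → ∀ (n : ℕ) (c : Fin n → Euc d), (∀ i, c i ∈ K) →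
      (Pairwise fun i j => Disjoint (ball (c i) r) (ball (c j) r)) → (n : ℝ) ≤ C * (r⁻¹) ^ d := by
  obtain ⟨R, hR, hKR⟩ := hK.subset_ball_lt 0 0
  refine ⟨(R + 1) ^ d, one_le_pow₀ (by linarith), fun r hr hr1 n c hc hd => ?_⟩
  set v := (volume : Measure (Euc d)) (ball 0 1) with hv
  have hv0 : v ≠ 0 := (measure_ball_pos _ _ one_pos).ne'
  have hvt : v ≠ ⊤ := measure_ball_lt_top.ne
  have h1 : ∑ i, volume (ball (c i) r) ≤ volume (ball (0 : Euc d) (R + 1)) := by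
    rw [← tsum_fintype (L := .unconditional _), ← measure_iUnion hd (fun i => measurableSet_ball)]
    refine measure_mono (iUnion_subset fun i => ball_subset_ball' ?_)
    have := mem_ball.1 (hKR (hc i))
    linarith
  simp only [Measure.addHaar_ball_of_pos volume _ hr, Finset.sum_const, Finset.card_univ,
    Fintype.card_fin, Measure.addHaar_ball_of_pos volume _ (by linarith : (0 : ℝ) < R + 1),
    finrank_euclideanSpace, nsmul_eq_mul] at h1
  rw [← mul_assoc, ENNReal.mul_le_mul_iff_left hv0 hvt, ← ENNReal.ofReal_natCast,
    ← ENNReal.ofReal_mul (by positivity), ENNReal.ofReal_le_ofReal_iff (by positivity)] at h1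
  rw [inv_pow, ← div_eq_mul_inv, le_div_iff₀ (by positivity)]
  exact h1

theorem bddAbove_packing {K E : Set (Euc d)} (hK : Bornology.IsBounded K) (hE : E ⊆ K) {r : ℝ}
    (hr : 0 < r) (hr1 : r < 1) :
    BddAbove {n : ℕ | ∃ c : Fin n → Euc d, (∀ i, c i ∈ E) ∧
      Pairwise fun i j => Disjoint (ball (c i) r) (ball (c j) r)} := by
  obtain ⟨C, _, h⟩ := exists_packing_card_le hK
  refine ⟨⌈C * (r⁻¹) ^ d⌉₊, ?_⟩
  rintro n ⟨c, hc, hd⟩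
  exact_mod_cast (h r hr hr1 n c (fun i => hE (hc i)) hd).trans (Nat.le_ceil _)

theorem exists_packing {K E : Set (Euc d)} (hK : Bornology.IsBounded K) (hE : E ⊆ K) {r : ℝ}
    (hr : 0 < r) (hr1 : r < 1) :
    ∃ c : Fin (packingNumber E r) → Euc d, (∀ i, c i ∈ E) ∧
      Pairwise fun i j => Disjoint (ball (c i) r) (ball (c j) r) :=
  Nat.sSup_mem (s := {n : ℕ | ∃ c : Fin n → Euc d, (∀ i, c i ∈ E) ∧
      Pairwise fun i j => Disjoint (ball (c i) r) (ball (c j) r)})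
    ⟨0, Fin.elim0, fun i => i.elim0, fun i => i.elim0⟩ (bddAbove_packing hK hE hr hr1)

theorem packingNumber_mono {K E F : Set (Euc d)} (hK : Bornology.IsBounded K) (hF : F ⊆ K)
    (hEF : E ⊆ F) {r : ℝ} (hr : 0 < r) (hr1 : r < 1) :
    packingNumber E r ≤ packingNumber F r := by
  obtain ⟨c, hc, hd⟩ := exists_packing hK (hEF.trans hF) hr hr1
  exact le_csSup (bddAbove_packing hK hF hr hr1) ⟨c, fun i => hEF (hc i), hd⟩

theorem one_le_packingNumber {K E : Set (Euc d)} (hK : Bornology.IsBounded K) (hE : E ⊆ K)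
    (hne : E.Nonempty) {r : ℝ} (hr : 0 < r) (hr1 : r < 1) :
    1 ≤ packingNumber E r := by
  obtain ⟨x, hx⟩ := hne
  exact le_csSup (bddAbove_packing hK hE hr hr1)
    ⟨fun _ => x, fun _ => hx, fun i j hij => absurd (Subsingleton.elim i j) hij⟩

theorem exists_cover {K E : Set (Euc d)} (hK : Bornology.IsBounded K) (hE : E ⊆ K) {r : ℝ}
    (hr : 0 < r) (hr1 : r < 1) :
    ∃ c : Fin (packingNumber E r) → Euc d, E ⊆ ⋃ i, ball (c i) (2 * r) := by
  obtain ⟨c, hc, hd⟩ := exists_packing hK hE hr hr1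
  refine ⟨c, fun x hx => ?_⟩
  by_contra hcon
  have hfar : ∀ i, Disjoint (ball x r) (ball (c i) r) := fun i => by
    refine ball_disjoint_ball ?_
    have : ¬ dist x (c i) < 2 * r := fun h => hcon (mem_iUnion.2 ⟨i, h⟩)
    linarith
  have : packingNumber E r + 1 ≤ packingNumber E r := by
    refine le_csSup (bddAbove_packing hK hE hr hr1) ⟨Fin.cons x c, ?_, ?_⟩
    · intro i
      refine Fin.cases hx (fun j => hc j) i
    · intro i j
      refine Fin.cases ?_ (fun i => ?_) i <;> refine Fin.cases ?_ (fun j => ?_) j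
      · simp
      · intro _; simpa using hfar j
      · intro _; simpa using (hfar i).symm
      · intro hij
        simpa using hd (fun h => hij (by rw [h]))
  omega

theorem exists_log_packingNumber_le {K : Set (Euc d)} (hK : Bornology.IsBounded K) :
    ∃ B : ℝ, 0 ≤ B ∧ ∀ r : ℝ, 0 < r → r < 1 →
      Real.log (packingNumber K r) ≤ B + d * (-Real.log r) := by
  obtain ⟨C, hC, h⟩ := exists_packing_card_le hK
  refine ⟨Real.log C, Real.log_nonneg hC, fun r hr hr1 => ?_⟩
  obtain ⟨c, hc, hd⟩ := exists_packing hK subset_rfl hr hr1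
  have hle := h r hr hr1 _ c hc hd
  have hlr : 0 < -Real.log r := by linarith [Real.log_neg hr hr1]
  rcases Nat.eq_zero_or_pos (packingNumber K r) with h0 | h0
  · rw [h0]
    simp only [Nat.cast_zero, Real.log_zero]
    have := Real.log_nonneg hC
    positivity
  · have := Real.log_le_log (by exact_mod_cast h0) hle
    rwa [Real.log_mul (by positivity) (by positivity), Real.log_pow, Real.log_inv] at this

/-- A set whose image lies in `E` contributes to `-I_μ(4r,1)` at most its mass times
`log P_r(E)`, up to an additive constant. -/
theorem setLIntegral_neg_log_le_packing {K E : Set (Euc d)} (hK : Bornology.IsBounded K)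
    (hE : E ⊆ K) (μ : Measure K) [IsProbabilityMeasure μ] {A : Set K} (hA : MeasurableSet A)
    (hAE : Subtype.val '' A ⊆ E) {r : ℝ} (hr : 0 < r) (hr1 : r < 1) :
    ∫⁻ x in A, ENNReal.ofReal (-Real.log (μ (ball x (4 * r))).toReal) ∂μ
      ≤ μ A * ENNReal.ofReal (Real.log (packingNumber E r)) + 1 := by
  obtain ⟨c, hc⟩ := exists_cover hK hE hr hr1
  refine setLIntegral_neg_log_le μ hA (fun i => Subtype.val ⁻¹' ball (c i) (2 * r))
    (fun i => measurable_subtype_coe measurableSet_ball) ?_ ?_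
  · intro x hx
    obtain ⟨i, hi⟩ := mem_iUnion.1 (hc (hAE ⟨x, hx, rfl⟩))
    exact mem_iUnion.2 ⟨i, hi⟩
  · intro i x hx y hy
    have hx' : dist (x : Euc d) (c i) < 2 * r := hx
    have hy' : dist (y : Euc d) (c i) < 2 * r := hy
    have := dist_triangle_right (y : Euc d) x (c i)
    rw [Subtype.dist_eq]
    linarith

/-- Entropy bound by a finite family of closed balls and a remainder. -/
theorem logEnt_le_of_closedBall {K : Set (Euc d)} (hK : Bornology.IsBounded K)
    (μ : Measure K) [IsProbabilityMeasure μ] (Z : Finset K) (η : ℝ) (E : K → Set (Euc d))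
    (hE : ∀ z, E z ⊆ K) (hZE : ∀ z, Subtype.val '' closedBall z η ⊆ E z)
    {r : ℝ} (hr : 0 < r) (hr1 : r < 1) :
    logEnt μ (4 * r) ≤
      (∑ z ∈ Z, (μ (closedBall z η) * ENNReal.ofReal (Real.log (packingNumber (E z) r)) + 1)) +
      (μ (⋃ z ∈ Z, ball z η)ᶜ * ENNReal.ofReal (Real.log (packingNumber K r)) + 1) := by
  refine (lintegral_le_sum_of_cover Z (fun z => closedBall z η) (⋃ z ∈ Z, ball z η)ᶜ ?_ _).trans ?_
  · intro x _
    by_cases h : x ∈ ⋃ z ∈ Z, ball z η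
    · exact Or.inl (iUnion₂_mono (fun z _ => ball_subset_closedBall) h)
    · exact Or.inr h
  · gcongr with z
    · exact setLIntegral_neg_log_le_packing hK (hE z) μ isClosed_closedBall.measurableSet
        (hZE z) hr hr1
    · refine setLIntegral_neg_log_le_packing hK subset_rfl μ ?_ ?_ hr hr1
      · exact (isOpen_biUnion fun z _ => isOpen_ball).isClosed_compl.measurableSet
      · rintro _ ⟨x, _, rfl⟩
        exact x.2

theorem logEnt_ne_top {K : Set (Euc d)} (hK : Bornology.IsBounded K)
    (μ : Measure K) [IsProbabilityMeasure μ] {r : ℝ} (hr : 0 < r) (hr1 : r < 4) :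
    logEnt μ r ≠ ⊤ := by
  have h := logEnt_le_of_closedBall hK μ ∅ 0 (fun _ => K) (fun _ => subset_rfl)
    (fun z => by rintro _ ⟨x, _, rfl⟩; exact x.2) (r := r / 4) (by linarith) (by linarith)
  rw [mul_div_cancel₀ _ (by norm_num : (4 : ℝ) ≠ 0)] at h
  refine ne_top_of_le_ne_top ?_ h
  simp

theorem log_packingNumber_mono {K E F : Set (Euc d)} (hK : Bornology.IsBounded K)
    (hF : F ⊆ K) (hEF : E ⊆ F) (hne : E.Nonempty) {r : ℝ} (hr : 0 < r) (hr1 : r < 1) :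
    Real.log (packingNumber E r) ≤ Real.log (packingNumber F r) := by
  have h1 := one_le_packingNumber hK (hEF.trans hF) hne hr hr1
  have h2 := packingNumber_mono hK hF hEF hr hr1
  exact Real.log_le_log (by exact_mod_cast h1) (by exact_mod_cast h2)

end Packing

section Approximation

theorem exists_pos_forall_le {κ : Type*} [Finite κ] {f : κ → ℝ} (hf : ∀ k, 0 < f k) :
    ∃ ε > 0, ∀ k, ε ≤ f k := by
  have h : ∀ᶠ ε in 𝓝[>] (0 : ℝ), 0 < ε ∧ ∀ k, ε ≤ f k :=
    Filter.Eventually.and (eventually_mem_nhdsWithin (a := (0 : ℝ)) (s := Ioi 0))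
      (eventually_all.2 fun k => mem_nhdsWithin_of_mem_nhds (Iic_mem_nhds (hf k)))
  exact h.exists

theorem exists_separation {X κ : Type*} [MetricSpace X] [Finite κ] (y : κ → X) :
    ∃ η > 0, ∀ k l, y k ≠ y l → η ≤ dist (y k) (y l) := by
  obtain ⟨η, hη, h⟩ := exists_pos_forall_le
    (f := fun s : {s : κ × κ // y s.1 ≠ y s.2} => dist (y s.1.1) (y s.1.2))
    (fun s => dist_pos.2 s.2)
  exact ⟨η, hη, fun k l hkl => h ⟨(k, l), hkl⟩⟩

theorem tendsto_neg_log_nhdsGT_zero : Tendsto (fun r : ℝ => -Real.log r) (𝓝[>] 0) atTop :=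
  tendsto_neg_atBot_atTop.comp Real.tendsto_log_nhdsGT_zero

theorem eventually_lt_nhdsGT_zero {ε : ℝ} (hε : 0 < ε) : ∀ᶠ r in 𝓝[>] (0 : ℝ), 0 < r ∧ r < ε :=
  Ioo_mem_nhdsGT hε

theorem le_dist_of_disjoint_ball {X : Type*} [MetricSpace X] {a b : X} {r : ℝ} (hr : 0 < r)
    (h : Disjoint (ball a r) (ball b r)) : r ≤ dist a b := by
  by_contra hlt
  exact disjoint_left.1 h (mem_ball_self hr) (mem_ball.2 (not_le.1 hlt))

variable {d : ℕ} {K : Set (Euc d)}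

/-- Near a finitely supported measure, `I_μ(r,1)` stays bounded at some small scale. -/
theorem atomicProb_mem_interior_small {κ : Type*} [Fintype κ] (hK : Bornology.IsBounded K)
    (p : κ → ℝ) (hp : ∀ k, 0 ≤ p k) (hp1 : ∑ k, p k = 1) (x : κ → K) {ε : ℝ} (hε : 0 < ε) :
    atomicProb p hp hp1 x ∈
      interior {μ : ProbabilityMeasure K | ∃ r, 0 < r ∧ r < ε ∧ Dq (μ : Measure K) r 1 ≤ ε} := by
  classical
  set Z := Finset.univ.image x with hZ
  obtain ⟨r, ⟨hr, hrε⟩, ⟨_, hr1⟩, hL⟩ := ((eventually_lt_nhdsGT_zero hε).and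
    ((eventually_lt_nhdsGT_zero one_pos).and
    (tendsto_neg_log_nhdsGT_zero.eventually_ge_atTop ((Z.card + 2) / ε)))).exists
  set s := r / 4 with hs
  have hrs : r = 4 * s := by rw [hs]; ring
  set R : Set K := (⋃ z ∈ Z, ball z (s / 2))ᶜ with hR
  have hRc : IsClosed R := (isOpen_biUnion fun z _ => isOpen_ball).isClosed_compl
  set l := ENNReal.ofReal (Real.log (packingNumber K s)) with hl
  refine mem_interior.2 ⟨{μ | (μ : Measure K) R < (l + 1)⁻¹}, fun μ hμ => ?_,
    isOpen_setOf_measure_lt hRc _, ?_⟩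
  · refine ⟨r, hr, hrε, ?_⟩
    have hent : logEnt (μ : Measure K) r ≤ ENNReal.ofReal (Z.card + 2) := by
      refine (lintegral_le_sum_of_cover Z (fun z => ball z (s / 2)) R ?_ _).trans ?_
      · intro y _
        exact em _
      have h1 : ∀ z ∈ Z, ∫⁻ y in ball z (s / 2),
          ENNReal.ofReal (-Real.log ((μ : Measure K) (ball y r)).toReal) ∂(μ : Measure K) ≤ 1 := by
        intro z _
        refine (setLIntegral_neg_log_le (μ : Measure K) measurableSet_ball
          (fun _ : Fin 1 => ball z (s / 2)) (fun _ => measurableSet_ball)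
          (fun y hy => mem_iUnion.2 ⟨0, hy⟩) ?_).trans (by simp)
        intro _ a ha b hb
        have := dist_triangle_right b a z
        have ha' := mem_ball.1 ha
        have hb' := mem_ball.1 hb
        linarith
      have h2 : ∫⁻ y in R,
          ENNReal.ofReal (-Real.log ((μ : Measure K) (ball y r)).toReal) ∂(μ : Measure K) ≤ 2 := by
        rw [hrs]
        refine (setLIntegral_neg_log_le_packing hK subset_rfl (μ : Measure K) hRc.measurableSet
          (by rintro _ ⟨y, _, rfl⟩; exact y.2) (by linarith) (by linarith)).trans ?_
        refine (add_le_add_left ?_ 1).trans one_add_one_eq_two.le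
        calc (μ : Measure K) R * l ≤ (l + 1)⁻¹ * (l + 1) := by
              gcongr
              · exact le_of_lt hμ
              · exact le_self_add
          _ ≤ 1 := ENNReal.inv_mul_le_one _
      refine (add_le_add (Finset.sum_le_sum h1) h2).trans ?_
      rw [ENNReal.ofReal_add (Nat.cast_nonneg _) zero_le_two, Finset.sum_const, nsmul_eq_mul,
        mul_one, ENNReal.ofReal_natCast, ENNReal.ofReal_ofNat]
    have hent' := ENNReal.toReal_le_of_le_ofReal
      (add_nonneg (Nat.cast_nonneg _) zero_le_two) hent
    rw [Dq_one_eq_logEnt]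
    have hLpos : 0 < -Real.log r := by linarith [Real.log_neg hr hr1]
    rw [div_le_iff₀ hLpos]
    rw [div_le_iff₀ hε] at hL
    linarith
  · have h0 : (atomicProb p hp hp1 x : Measure K) R = 0 := by
      refine atomic_apply_eq_zero hp hRc.measurableSet fun k hk => ?_
      exact hk (mem_iUnion₂.2 ⟨x k, by simp [hZ], mem_ball_self (by linarith)⟩)
    change (atomicProb p hp hp1 x : Measure K) R < _
    rw [h0]
    simp [hl]

/-- All measures near a finitely supported one have upper dimension controlled by the box counts
around its atoms. -/
theorem atomicProb_mem_interior_upperDim_le {κ : Type*} [Fintype κ] (hK : Bornology.IsBounded K)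
    (p : κ → ℝ) (hp : ∀ k, 0 ≤ p k) (hp1 : ∑ k, p k = 1) (y : κ → K) {ρ s t : ℝ} (hρ : 0 < ρ)
    (hst : s < t)
    (h : ∀ᶠ r in 𝓝[>] (0 : ℝ), ∑ k, p k * Real.log (packingNumber (K ∩ ball (y k : Euc d) ρ) r)
      ≤ s * (-Real.log r)) :
    atomicProb p hp hp1 y ∈
      interior {μ : ProbabilityMeasure K | upperDim (μ : Measure K) 1 ≤ (t : EReal)} := by
  classical
  obtain ⟨B, hB, hlogK⟩ := exists_log_packingNumber_le hK
  obtain ⟨η₀, hη₀, hsep⟩ := exists_separation y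
  set η := min (η₀ / 2) (ρ / 2) with hη
  have hηpos : 0 < η := by positivity
  have hη0 : η < η₀ := (min_le_left _ _).trans_lt (half_lt_self hη₀)
  have hηρ : η < ρ := (min_le_right _ _).trans_lt (half_lt_self hρ)
  set Z := Finset.univ.image y with hZ
  set w : K → ℝ := fun z => ∑ k with y k = z, p k with hw
  have hw0 : ∀ z, 0 ≤ w z := fun z => Finset.sum_nonneg fun k _ => hp k
  set m : ℝ := (Z.card : ℝ) with hm
  have hm0 : 0 ≤ m := by positivity
  set δ : ℝ := (t - s) / (2 * ((m + 1) * d + 1)) with hδ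
  have hδ0 : 0 < δ := div_pos (by linarith) (by positivity)
  have hδ1 : δ * ((m + 1) * d + 1) = (t - s) / 2 := by
    rw [hδ]; field_simp
  set R : Set K := (⋃ z ∈ Z, ball z η)ᶜ with hR
  have hRc : IsClosed R := (isOpen_biUnion fun z _ => isOpen_ball).isClosed_compl
  refine mem_interior.2 ⟨(⋂ z ∈ Z, {μ : ProbabilityMeasure K |
      (μ : Measure K) (closedBall z η) < ENNReal.ofReal (w z + δ)}) ∩
      {μ | (μ : Measure K) R < ENNReal.ofReal δ}, fun μ hμ => ?_,
    (isOpen_biInter_finset fun z _ => isOpen_setOf_measure_lt isClosed_closedBall _).inter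
      (isOpen_setOf_measure_lt hRc _), ?_⟩
  · have hμZ : ∀ z ∈ Z, (μ : Measure K) (closedBall z η) < ENNReal.ofReal (w z + δ) :=
      fun z hz => mem_iInter₂.1 hμ.1 z hz
    have hμR : (μ : Measure K) R < ENNReal.ofReal δ := hμ.2
    set c : ℝ := δ * (m + 1) * B + m + 1 + t * Real.log 4 with hc
    have hev : ∀ᶠ r in 𝓝[>] (0 : ℝ), Dq (μ : Measure K) (4 * r) 1 ≤ t := by
      filter_upwards [h, eventually_lt_nhdsGT_zero (show (0 : ℝ) < 1 / 4 by norm_num),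
        tendsto_neg_log_nhdsGT_zero.eventually_ge_atTop (c / ((t - s) / 2))] with r hr1 hr2 hr3
      obtain ⟨hr, hr4⟩ := hr2
      have hr' : r < 1 := by linarith
      set F : K → ℝ := fun z => Real.log (packingNumber (K ∩ ball (z : Euc d) ρ) r) with hF
      set FK : ℝ := Real.log (packingNumber K r) with hFK
      have hF0 : ∀ z, 0 ≤ F z := fun z => Real.log_natCast_nonneg _
      have hFle : ∀ z, F z ≤ FK := fun z => by
        have h1 := one_le_packingNumber hK (inter_subset_left (t := ball (z : Euc d) ρ))
          ⟨z, z.2, mem_ball_self hρ⟩ hr hr'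
        have h2 := packingNumber_mono hK subset_rfl
          (inter_subset_left (s := K) (t := ball (z : Euc d) ρ)) hr hr'
        exact Real.log_le_log (by exact_mod_cast h1) (by exact_mod_cast h2)
      have hFK0 : 0 ≤ FK := Real.log_natCast_nonneg _
      have hent : logEnt (μ : Measure K) (4 * r) ≤
          ENNReal.ofReal ((∑ z ∈ Z, ((w z + δ) * F z + 1)) + (δ * FK + 1)) := by
        refine (logEnt_le_of_closedBall hK (μ : Measure K) Z η
          (fun z => K ∩ ball (z : Euc d) ρ) (fun z => inter_subset_left) ?_ hr hr').trans ?_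
        · rintro z _ ⟨a, ha, rfl⟩
          exact ⟨a.2, (mem_closedBall.1 ha).trans_lt hηρ⟩
        · have hnn : ∀ z, 0 ≤ w z + δ := fun z => by have := hw0 z; linarith
          have hnn' : ∀ z, 0 ≤ (w z + δ) * F z := fun z => mul_nonneg (hnn z) (hF0 z)
          rw [ENNReal.ofReal_add (Finset.sum_nonneg fun z _ => by have := hnn' z; linarith)
            (by positivity), ENNReal.ofReal_sum_of_nonneg (fun z _ => by have := hnn' z; linarith),
            ENNReal.ofReal_add (by positivity) zero_le_one, ENNReal.ofReal_mul hδ0.le,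
            ENNReal.ofReal_one]
          gcongr with z hz
          rw [ENNReal.ofReal_add (hnn' z) zero_le_one, ENNReal.ofReal_mul (hnn z),
            ENNReal.ofReal_one]
          gcongr
          exact (hμZ z hz).le
      have hsum : ∑ z ∈ Z, w z * F z = ∑ k, p k * F (y k) := by
        rw [← Finset.sum_fiberwise_of_maps_to (s := Finset.univ) (t := Z) (g := y)
          (fun k _ => by simp [hZ])]
        refine Finset.sum_congr rfl fun z _ => ?_
        rw [hw, Finset.sum_mul]
        refine Finset.sum_congr rfl fun k hk => ?_
        rw [(Finset.mem_filter.1 hk).2]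
      have hbound : (∑ z ∈ Z, ((w z + δ) * F z + 1)) + (δ * FK + 1) ≤
          s * (-Real.log r) + δ * (m + 1) * FK + m + 1 := by
        have h1 : ∑ z ∈ Z, ((w z + δ) * F z + 1) ≤ ∑ z ∈ Z, (w z * F z + (δ * FK + 1)) := by
          refine Finset.sum_le_sum fun z _ => ?_
          have := mul_le_mul_of_nonneg_left (hFle z) hδ0.le
          linarith
        rw [Finset.sum_add_distrib (f := fun z => w z * F z), hsum, Finset.sum_const, nsmul_eq_mul,
            ← hm] at h1
        have h2 : ∑ k, p k * F (y k) ≤ s * (-Real.log r) := hr1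
        linarith
      have hrhs : 0 ≤ (∑ z ∈ Z, ((w z + δ) * F z + 1)) + (δ * FK + 1) := by
        have : ∀ z ∈ Z, 0 ≤ (w z + δ) * F z + 1 := fun z _ => by
          have := hw0 z
          have := hF0 z
          positivity
        have := Finset.sum_nonneg this
        positivity
      have hent' := ENNReal.toReal_le_of_le_ofReal hrhs hent
      rw [Dq_one_eq_logEnt]
      have hLpos : 0 < -Real.log (4 * r) := by
        linarith [Real.log_neg (by linarith : 0 < 4 * r) (by linarith)]
      rw [div_le_iff₀ hLpos, Real.log_mul (by norm_num) hr.ne']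
      rw [div_le_iff₀ (by linarith)] at hr3
      have hK' := mul_le_mul_of_nonneg_left (hlogK r hr hr') (by positivity : 0 ≤ δ * (m + 1))
      have hL0 : 0 ≤ -Real.log r := by linarith [Real.log_neg hr hr']
      have hd : δ * (m + 1) * d * (-Real.log r) ≤ (t - s) / 2 * (-Real.log r) := by
        refine mul_le_mul_of_nonneg_right ?_ hL0
        rw [← hδ1]
        nlinarith
      nlinarith
    have htend : Tendsto (fun r : ℝ => r / 4) (𝓝[>] 0) (𝓝[>] 0) := by
      refine tendsto_nhdsWithin_iff.2 ⟨?_, ?_⟩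
      · have : Tendsto (fun r : ℝ => r / 4) (𝓝 0) (𝓝 (0 / 4)) := tendsto_id.div_const 4
        rw [zero_div] at this
        exact this.mono_left nhdsWithin_le_nhds
      · filter_upwards [self_mem_nhdsWithin] with r hr
        exact div_pos (mem_Ioi.1 hr) (by norm_num : (0 : ℝ) < 4)
    have hev' : ∀ᶠ r in 𝓝[>] (0 : ℝ), ((Dq (μ : Measure K) r 1 : ℝ) : EReal) ≤ t := by
      filter_upwards [htend.eventually hev] with r hr
      rw [mul_div_cancel₀ _ (by norm_num : (4 : ℝ) ≠ 0)] at hr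
      exact_mod_cast hr
    exact limsup_le_of_le (by isBoundedDefault) hev'
  · refine ⟨mem_iInter₂.2 fun z hz => ?_, ?_⟩
    · change atomic p y (closedBall z η) < _
      rw [atomic_apply hp y isClosed_closedBall.measurableSet]
      have hwz := hw0 z
      rw [ENNReal.ofReal_lt_ofReal_iff (by linarith)]
      obtain ⟨l, -, rfl⟩ := Finset.mem_image.1 hz
      have : (Finset.univ.filter fun k => y k ∈ closedBall (y l) η) =
          Finset.univ.filter fun k => y k = y l := by
        refine Finset.filter_congr fun k _ => ⟨fun hk => ?_, fun hk => ?_⟩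
        · by_contra hne
          exact absurd (hsep k l hne) (not_le.2 ((mem_closedBall.1 hk).trans_lt hη0))
        · rw [hk]; exact mem_closedBall_self hηpos.le
      rw [this]
      change w (y l) < _
      linarith
    · change atomic p y R < _
      rw [atomic_apply_eq_zero hp hRc.measurableSet fun k hk =>
        hk (mem_iUnion₂.2 ⟨y k, by simp [hZ], mem_ball_self hηpos⟩)]
      exact ENNReal.ofReal_pos.2 hδ0

/-- The entropy of well-separated atoms bounds `-I_μ(r/2,1)` from below near an atomic measure. -/
theorem atomicProb_mem_interior_le_logEnt {κ : Type*} [Fintype κ] (hK : Bornology.IsBounded K)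
    (m : κ → ℝ) (hm : ∀ k, 0 < m k) (hm1 : ∑ k, m k = 1) (y : κ → K) {r c : ℝ} (hr : 0 < r)
    (hr8 : r < 8) (hy : ∀ k l, k ≠ l → r ≤ dist (y k) (y l))
    (hc : c < ∑ k, m k * (-Real.log (m k))) :
    atomicProb m (fun k => (hm k).le) hm1 y ∈
      interior {μ : ProbabilityMeasure K | c ≤ (logEnt (μ : Measure K) (r / 2)).toReal} := by
  classical
  have hcont : ContinuousAt
      (fun δ : ℝ => ∑ k, (1 - δ) * m k * (-Real.log ((1 + δ) * m k))) 0 := by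
    refine tendsto_finsetSum _ fun k _ => ?_
    have h1 : ContinuousAt (fun δ : ℝ => (1 - δ) * m k) 0 := by fun_prop
    have h2 : ContinuousAt (fun δ : ℝ => (1 + δ) * m k) 0 := by fun_prop
    exact h1.mul (h2.log (by simpa using (hm k).ne')).neg
  have hev : ∀ᶠ δ in 𝓝[>] (0 : ℝ), c < ∑ k, (1 - δ) * m k * (-Real.log ((1 + δ) * m k)) := by
    refine nhdsWithin_le_nhds (hcont.eventually (lt_mem_nhds ?_))
    simpa using hc
  obtain ⟨δ, hδc, hδ, hδ1⟩ := (hev.and (eventually_lt_nhdsGT_zero one_pos)).exists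
  have hmass : ∀ k (s : Set K), MeasurableSet s → y k ∈ s → s ⊆ ball (y k) r →
      atomic m y s = ENNReal.ofReal (m k) := by
    intro k s hs hks hsr
    rw [atomic_apply (fun k => (hm k).le) y hs, Finset.sum_eq_single k]
    · intro l hl hlk
      rw [Finset.mem_filter] at hl
      exact absurd (mem_ball.1 (hsr hl.2)) (not_lt.2 (hy l k hlk))
    · intro h
      exact absurd (Finset.mem_filter.2 ⟨Finset.mem_univ k, hks⟩) h
  refine mem_interior.2 ⟨⋂ k, ({μ : ProbabilityMeasure K |
      ENNReal.ofReal ((1 - δ) * m k) < (μ : Measure K) (ball (y k) (r / 4))} ∩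
      {μ | (μ : Measure K) (closedBall (y k) (3 * r / 4)) < ENNReal.ofReal ((1 + δ) * m k)}),
    fun μ hμ => ?_, isOpen_iInter_of_finite fun k =>
      (isOpen_setOf_lt_measure isOpen_ball _).inter (isOpen_setOf_measure_lt isClosed_closedBall _),
    mem_iInter.2 fun k => ⟨?_, ?_⟩⟩
  · have hμ' := mem_iInter.1 hμ
    have hent := le_logEnt (μ : Measure K) (half_pos hr) (fun k => ball (y k) (r / 4))
      (fun k => measurableSet_ball) (fun k l hkl => ball_disjoint_ball (by
        have := hy k l hkl
        linarith))
      (fun k => (1 - δ) * m k) (fun k => (1 + δ) * m k)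
      (fun k => mul_nonneg (by linarith) (hm k).le) (fun k => (hμ' k).1.le)
      (fun k x hx => (measure_mono ((ball_subset_ball' (by
        have := mem_ball.1 hx
        linarith)).trans ball_subset_closedBall)).trans (hμ' k).2.le)
    have h := (ENNReal.ofReal_le_iff_le_toReal
      (logEnt_ne_top hK (μ : Measure K) (half_pos hr) (by linarith))).1 hent
    exact hδc.le.trans h
  · change _ < atomic m y _
    rw [hmass k _ measurableSet_ball (mem_ball_self (by linarith))
      (ball_subset_ball (by linarith)), ENNReal.ofReal_lt_ofReal_iff (hm k)]
    nlinarith [hm k]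
  · change atomic m y _ < _
    rw [hmass k _ measurableSet_closedBall (mem_closedBall_self (by linarith))
      (closedBall_subset_ball (by linarith)), ENNReal.ofReal_lt_ofReal_iff
        (mul_pos (by linarith) (hm k))]
    nlinarith [hm k]

theorem sum_mul_log_le_entropy {ι : Type*} [Fintype ι] {p : ι → ℝ} (hp : ∀ i, 0 < p i)
    (hp1 : ∑ i, p i = 1) {P : ι → ℕ} (hP : ∀ i, 1 ≤ P i) :
    ∑ i, p i * Real.log (P i) ≤
      ∑ s : Σ i, Fin (P i), p s.1 / P s.1 * (-Real.log (p s.1 / P s.1)) := by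
  rw [Fintype.sum_sigma]
  refine Finset.sum_le_sum fun i _ => ?_
  have hPi : (0 : ℝ) < P i := by exact_mod_cast hP i
  have hpi : p i ≤ 1 := hp1 ▸ Finset.single_le_sum (fun j _ => (hp j).le) (Finset.mem_univ i)
  simp only
  rw [Finset.sum_const, Finset.card_univ, Fintype.card_fin, nsmul_eq_mul, ← mul_assoc,
    mul_div_cancel₀ _ hPi.ne', Real.log_div (hp i).ne' hPi.ne']
  have := Real.log_nonpos (hp i).le hpi
  exact mul_le_mul_of_nonneg_left (by linarith) (hp i).le

/-- Splitting each atom over a maximal packing around it makes `Dq` large at a small scale. -/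
theorem exists_mem_interior_le_Dq (hK : Bornology.IsBounded K) {O : Set (ProbabilityMeasure K)}
    (hO : IsOpen O) {N : ℕ} (p : Fin N → ℝ) (hp : ∀ i, 0 < p i) (hp1 : ∑ i, p i = 1)
    (x : Fin N → K) (hx : Function.Injective x)
    (hxO : atomicProb p (fun i => (hp i).le) hp1 x ∈ O) {t : ℝ}
    (ht : (t : EReal) < convUpperBoxDim K) {ε : ℝ} (hε : 0 < ε) :
    ∃ ν ∈ O, ν ∈ interior {μ : ProbabilityMeasure K |
      ∃ r, 0 < r ∧ r < ε ∧ t ≤ Dq (μ : Measure K) r 1} := by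
  obtain ⟨ρ₀, hρ₀, hmem⟩ := exists_forall_atomicProb_mem hO hxO
  obtain ⟨η, hη, hsep⟩ := exists_separation x
  set ρ := min ρ₀ (η / 4) with hρdef
  have hρ : 0 < ρ := lt_min hρ₀ (by linarith)
  have hρη : ρ ≤ η / 4 := min_le_right _ _
  have hN : 1 ≤ N := by
    rcases Nat.eq_zero_or_pos N with rfl | h
    · simp at hp1
    · exact h
  have hlim : (t : EReal) < limsup (fun r : ℝ =>
      (((∑ i, p i * Real.log (packingNumber (K ∩ ball (x i : Euc d) ρ) r : ℝ)) / (-Real.log r) : ℝ)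
        : EReal)) (𝓝[>] (0:ℝ)) := by
    refine ht.trans_le ?_
    unfold convUpperBoxDim
    exact iInf₂_le_of_le N hN <| iInf₂_le_of_le (fun i => (x i : Euc d)) (fun i => (x i).2) <|
      iInf₂_le_of_le ρ hρ <| iInf₂_le_of_le p hp <| iInf_le_of_le hp1 le_rfl
  obtain ⟨t₁, htt₁, ht₁⟩ := EReal.lt_iff_exists_real_btwn.1 hlim
  have htt₁' : t < t₁ := EReal.coe_lt_coe_iff.1 htt₁
  have hfreq := frequently_lt_of_lt_limsup (by isBoundedDefault) ht₁
  obtain ⟨r, hrt, ⟨hr, hrmin⟩, hrL⟩ := (hfreq.and_eventually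
    ((eventually_lt_nhdsGT_zero (lt_min (lt_min hε one_pos) (half_pos hη))).and
    (tendsto_neg_log_nhdsGT_zero.eventually_ge_atTop (t * Real.log 2 / (t₁ - t))))).exists
  have hrη : r < η / 2 := hrmin.trans_le (min_le_right _ _)
  have hr1 : r < 1 := hrmin.trans_le ((min_le_left _ _).trans (min_le_right _ _))
  have hrε : r < ε := hrmin.trans_le ((min_le_left _ _).trans (min_le_left _ _))
  have hL : 0 < -Real.log r := by linarith [Real.log_neg hr hr1]
  rw [EReal.coe_lt_coe_iff, lt_div_iff₀ hL] at hrt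
  rw [div_le_iff₀ (by linarith)] at hrL
  set P : Fin N → ℕ := fun i => packingNumber (K ∩ ball (x i : Euc d) ρ) r with hPdef
  have hP : ∀ i, 1 ≤ P i := fun i =>
    one_le_packingNumber hK inter_subset_left ⟨x i, (x i).2, mem_ball_self hρ⟩ hr hr1
  have hP0 : ∀ i, (0 : ℝ) < P i := fun i => by exact_mod_cast hP i
  choose c hcK hcd using fun i =>
    exists_packing hK (inter_subset_left (s := K) (t := ball (x i : Euc d) ρ)) hr hr1
  set y : (Σ i, Fin (P i)) → K := fun s => ⟨c s.1 s.2, (hcK s.1 s.2).1⟩ with hy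
  set m : (Σ i, Fin (P i)) → ℝ := fun s => p s.1 / P s.1 with hm
  have hm0 : ∀ s, 0 < m s := fun s => div_pos (hp s.1) (hP0 s.1)
  have hmp : ∀ i, ∑ _k : Fin (P i), p i / P i = p i := fun i => by
    rw [Finset.sum_const, Finset.card_univ, Fintype.card_fin, nsmul_eq_mul,
      mul_div_cancel₀ _ (hP0 i).ne']
  have hm1 : ∑ s, m s = 1 := by
    rw [Fintype.sum_sigma, ← hp1]
    exact Finset.sum_congr rfl fun i _ => hmp i
  have hyx : ∀ s, dist (y s) (x s.1) < ρ := fun s => (hcK s.1 s.2).2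
  have hysep : ∀ s s', s ≠ s' → r ≤ dist (y s) (y s') := by
    rintro ⟨i, a⟩ ⟨j, b⟩ hne
    by_cases hij : i = j
    · subst hij
      refine le_dist_of_disjoint_ball (X := Euc d) hr (hcd i ?_)
      rintro rfl
      exact hne rfl
    · have h1 := hsep i j (hx.ne hij)
      have h2 : dist (y ⟨i, a⟩) (x i) < ρ := hyx ⟨i, a⟩
      have h3 : dist (y ⟨j, b⟩) (x j) < ρ := hyx ⟨j, b⟩
      have h4 := dist_triangle4 (x i) (y ⟨i, a⟩) (y ⟨j, b⟩) (x j)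
      rw [dist_comm (x i) (y _)] at h4
      linarith
  refine ⟨atomicProb m (fun s => (hm0 s).le) hm1 y, hmem m _ hm1 (fun s => x s.1) y
    (atomic_sigma (fun i _ => (div_pos (hp i) (hP0 i)).le) hmp x)
    (fun s => (hyx s).trans_le (min_le_left _ _)), ?_⟩
  refine interior_mono ?_ (atomicProb_mem_interior_le_logEnt hK m hm0 hm1 y hr (by linarith)
    hysep (hrt.trans_le (sum_mul_log_le_entropy hp hp1 hP)))
  intro μ hμ
  refine ⟨r / 2, half_pos hr, by linarith, ?_⟩
  have hlog2 := Real.log_pos one_lt_two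
  rw [Dq_one_eq_logEnt, Real.log_div hr.ne' two_ne_zero, le_div_iff₀ (by linarith)]
  have hμ' : t₁ * -Real.log r ≤ (logEnt (μ : Measure K) (r / 2)).toReal := hμ
  nlinarith

/-- Splitting each atom according to a nearly optimal convex combination of local box counts makes
the upper dimension small in a whole neighbourhood. -/
theorem exists_mem_interior_upperDim_le (hK : Bornology.IsBounded K)
    {O : Set (ProbabilityMeasure K)} (hO : IsOpen O) {N : ℕ} (p : Fin N → ℝ) (hp : ∀ i, 0 < p i)
    (hp1 : ∑ i, p i = 1) (x : Fin N → K)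
    (hxO : atomicProb p (fun i => (hp i).le) hp1 x ∈ O) {t : ℝ}
    (ht : convUpperBoxDimMax K < (t : EReal)) :
    ∃ ν ∈ O, ν ∈ interior {μ : ProbabilityMeasure K |
      upperDim (μ : Measure K) 1 ≤ (t : EReal)} := by
  obtain ⟨ρ₀, hρ₀, hmem⟩ := exists_forall_atomicProb_mem hO hxO
  obtain ⟨s, hs, hst⟩ := EReal.lt_iff_exists_real_btwn.1 ht
  have hst' : s < t := EReal.coe_lt_coe_iff.1 hst
  have hlt : ∀ i, convUpperBoxDim (K ∩ ball (x i : Euc d) ρ₀) < s := fun i => by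
    refine lt_of_le_of_lt ?_ hs
    unfold convUpperBoxDimMax
    exact le_iSup₂_of_le (x i : Euc d) (x i).2 (le_iSup₂_of_le ρ₀ hρ₀ le_rfl)
  unfold convUpperBoxDim at hlt
  simp only [iInf_lt_iff] at hlt
  choose M hM z hz ρ' hρ' q hq hq1 hlim using hlt
  have hgap : ∀ s : Σ i, Fin (M i), 0 < min (ρ' s.1) (ρ₀ - dist (z s.1 s.2) (x s.1 : Euc d)) :=
    fun s => lt_min (hρ' s.1) (sub_pos.2 (hz s.1 s.2).2)
  obtain ⟨ρ, hρ, hρle⟩ := exists_pos_forall_le hgap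
  set y : (Σ i, Fin (M i)) → K := fun s => ⟨z s.1 s.2, (hz s.1 s.2).1⟩ with hy
  set w : (Σ i, Fin (M i)) → ℝ := fun s => p s.1 * q s.1 s.2 with hw
  have hw0 : ∀ s, 0 ≤ w s := fun s => mul_nonneg (hp s.1).le (hq s.1 s.2).le
  have hwp : ∀ i, ∑ k, p i * q i k = p i := fun i => by rw [← Finset.mul_sum, hq1, mul_one]
  have hw1 : ∑ s, w s = 1 := by
    rw [Fintype.sum_sigma, ← hp1]
    exact Finset.sum_congr rfl fun i _ => hwp i
  refine ⟨atomicProb w hw0 hw1 y, hmem w hw0 hw1 (fun s => x s.1) y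
    (atomic_sigma (fun i k => mul_nonneg (hp i).le (hq i k).le) hwp x)
    (fun s => (hz s.1 s.2).2), ?_⟩
  refine atomicProb_mem_interior_upperDim_le hK w hw0 hw1 y hρ hst' ?_
  have hev : ∀ᶠ r in 𝓝[>] (0 : ℝ), ∀ i, _ := eventually_all.2 fun i =>
    eventually_lt_of_limsup_lt (hlim i)
  filter_upwards [hev, eventually_lt_nhdsGT_zero one_pos] with r hr' hr
  obtain ⟨hr0, hr1⟩ := hr
  have hL : 0 < -Real.log r := by linarith [Real.log_neg hr0 hr1]
  rw [Fintype.sum_sigma]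
  calc ∑ i, ∑ k, p i * q i k * Real.log (packingNumber (K ∩ ball (z i k) ρ) r)
      ≤ ∑ i, p i * (s * (-Real.log r)) := by
        refine Finset.sum_le_sum fun i _ => ?_
        have hi := hr' i
        rw [EReal.coe_lt_coe_iff, div_lt_iff₀ hL] at hi
        simp only [mul_assoc]
        rw [← Finset.mul_sum]
        refine mul_le_mul_of_nonneg_left (le_trans (Finset.sum_le_sum fun k _ => ?_) hi.le)
          (hp i).le
        refine mul_le_mul_of_nonneg_left ?_ (hq i k).le
        have h := hρle ⟨i, k⟩
        have hρz : ρ ≤ ρ₀ - dist (z i k) (x i) := h.trans (min_le_right _ _)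
        have hsub : K ∩ ball (z i k) ρ ⊆ (K ∩ ball (x i : Euc d) ρ₀) ∩ ball (z i k) (ρ' i) :=
          fun a ha => ⟨⟨ha.1, ball_subset_ball' (by linarith) ha.2⟩,
            ball_subset_ball (h.trans (min_le_left _ _)) ha.2⟩
        exact log_packingNumber_mono hK (inter_subset_left.trans inter_subset_left) hsub
          ⟨z i k, (hz i k).1, mem_ball_self hρ⟩ hr0 hr1
    _ = s * (-Real.log r) := by rw [← Finset.sum_mul, hp1, one_mul]

theorem dense_interior_exists_Dq_le (hK : IsCompact K) {ε : ℝ} (hε : 0 < ε) :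
    Dense (interior {μ : ProbabilityMeasure K |
      ∃ r, 0 < r ∧ r < ε ∧ Dq (μ : Measure K) r 1 ≤ ε}) := by
  have : CompactSpace K := isCompact_iff_compactSpace.1 hK
  refine dense_iff_inter_open.2 fun O hO hne => ?_
  obtain ⟨N, p, hp, hp1, x, -, hxO⟩ := exists_atomicProb_mem hO hne
  exact ⟨_, hxO, atomicProb_mem_interior_small hK.isBounded p _ hp1 x hε⟩

theorem dense_interior_exists_le_Dq (hK : IsCompact K) {t : ℝ}
    (ht : (t : EReal) < convUpperBoxDim K) {ε : ℝ} (hε : 0 < ε) :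
    Dense (interior {μ : ProbabilityMeasure K |
      ∃ r, 0 < r ∧ r < ε ∧ t ≤ Dq (μ : Measure K) r 1}) := by
  have : CompactSpace K := isCompact_iff_compactSpace.1 hK
  refine dense_iff_inter_open.2 fun O hO hne => ?_
  obtain ⟨N, p, hp, hp1, x, hx, hxO⟩ := exists_atomicProb_mem hO hne
  exact exists_mem_interior_le_Dq hK.isBounded hO p hp hp1 x hx hxO ht hε

theorem dense_interior_upperDim_le (hK : IsCompact K) {t : ℝ}
    (ht : convUpperBoxDimMax K < (t : EReal)) :
    Dense (interior {μ : ProbabilityMeasure K | upperDim (μ : Measure K) 1 ≤ (t : EReal)}) := by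
  have : CompactSpace K := isCompact_iff_compactSpace.1 hK
  refine dense_iff_inter_open.2 fun O hO hne => ?_
  obtain ⟨N, p, hp, hp1, x, -, hxO⟩ := exists_atomicProb_mem hO hne
  exact exists_mem_interior_upperDim_le hK.isBounded hO p hp hp1 x hxO ht

theorem frequently_nhdsGT_zero {P : ℝ → Prop}
    (h : ∀ n : ℕ, ∃ r, 0 < r ∧ r < 1 / ((n : ℝ) + 1) ∧ P r) : ∃ᶠ r in 𝓝[>] (0 : ℝ), P r := by
  intro hev
  obtain ⟨u, hu, hsub⟩ := mem_nhdsGT_iff_exists_Ioo_subset.1 hev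
  obtain ⟨n, hn⟩ := exists_nat_one_div_lt (mem_Ioi.1 hu)
  obtain ⟨r, hr, hrn, hP⟩ := h n
  exact hsub ⟨hr, hrn.trans hn⟩ hP

theorem lowerDim_one_eq_zero (μ : Measure K) [IsProbabilityMeasure μ]
    (h : ∀ n : ℕ, ∃ r, 0 < r ∧ r < 1 / ((n : ℝ) + 1) ∧ Dq μ r 1 ≤ 1 / ((n : ℝ) + 1)) :
    lowerDim μ 1 = 0 := by
  refine le_antisymm ?_ ?_
  · refine EReal.le_of_forall_lt_iff_le.1 fun t ht => ?_
    have ht' : 0 < t := by exact_mod_cast ht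
    obtain ⟨n, hn⟩ := exists_nat_one_div_lt ht'
    have hfreq : ∃ᶠ r in 𝓝[>] (0 : ℝ), ((Dq μ r 1 : ℝ) : EReal) ≤ t := by
      refine frequently_nhdsGT_zero fun k => ?_
      obtain ⟨r, hr, hrk, hD⟩ := h (max n k)
      have hle : ∀ j ≤ max n k, 1 / (((max n k : ℕ) : ℝ) + 1) ≤ 1 / ((j : ℝ) + 1) :=
        fun j hj => Nat.one_div_le_one_div hj
      refine ⟨r, hr, hrk.trans_le (hle k (le_max_right _ _)), ?_⟩
      exact_mod_cast (hD.trans (hle n (le_max_left _ _))).trans hn.le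
    exact liminf_le_of_frequently_le hfreq (by isBoundedDefault)
  · have hev : ∀ᶠ r in 𝓝[>] (0 : ℝ), (0 : EReal) ≤ ((Dq μ r 1 : ℝ) : EReal) := by
      filter_upwards [eventually_lt_nhdsGT_zero one_pos] with r hr
      rw [Dq_one_eq_logEnt]
      have := Real.log_neg hr.1 hr.2
      exact_mod_cast div_nonneg ENNReal.toReal_nonneg (by linarith)
    exact le_liminf_of_le (by isBoundedDefault) hev

end Approximation

end TypicalMeasures

/-- A typical measure on an infinite compact `K ⊆ ℝ^d` satisfies `D̲_μ(1) = 0` and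
`D̄_μ(1) ∈ [dim̄_{B,conv}(K), dim̄_{B,conv,max}(K)]`. -/
theorem typical_L1_dim (d : ℕ) (K : Set (Euc d))
    (hK : IsCompact K) (hKinf : K.Infinite) :
    ∃ G : Set (ProbabilityMeasure ↥K),
      G ⊆ {μ : ProbabilityMeasure ↥K |
        lowerDim (μ : Measure ↥K) 1 = (0 : EReal) ∧
        convUpperBoxDim K ≤ upperDim (μ : Measure ↥K) 1 ∧
        upperDim (μ : Measure ↥K) 1 ≤ convUpperBoxDimMax K} ∧
      Dense G ∧ IsGδ G := by
  have : CompactSpace K := isCompact_iff_compactSpace.1 hK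
  have hpos : ∀ n : ℕ, (0 : ℝ) < 1 / ((n : ℝ) + 1) := fun n => Nat.one_div_pos_of_nat
  set A : ℕ → Set (ProbabilityMeasure K) := fun n => interior {μ |
    ∃ r, 0 < r ∧ r < 1 / ((n : ℝ) + 1) ∧ Dq (μ : Measure K) r 1 ≤ 1 / ((n : ℝ) + 1)} with hA
  set B : ℕ × {q : ℚ // ((q : ℝ) : EReal) < convUpperBoxDim K} → Set (ProbabilityMeasure K) :=
    fun j => interior {μ |
      ∃ r, 0 < r ∧ r < 1 / ((j.1 : ℝ) + 1) ∧ ((j.2 : ℚ) : ℝ) ≤ Dq (μ : Measure K) r 1} with hB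
  set C : {q : ℚ // convUpperBoxDimMax K < ((q : ℝ) : EReal)} → Set (ProbabilityMeasure K) :=
    fun q => interior {μ | upperDim (μ : Measure K) 1 ≤ (((q : ℚ) : ℝ) : EReal)} with hC
  have hAG : IsGδ (⋂ n, A n) := .iInter_of_isOpen fun _ => isOpen_interior
  have hBG : IsGδ (⋂ j, B j) := .iInter_of_isOpen fun _ => isOpen_interior
  have hCG : IsGδ (⋂ q, C q) := .iInter_of_isOpen fun _ => isOpen_interior
  have hAd : Dense (⋂ n, A n) := dense_iInter_of_isOpen (fun _ => isOpen_interior)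
    fun n => dense_interior_exists_Dq_le hK (hpos n)
  have hBd : Dense (⋂ j, B j) := dense_iInter_of_isOpen (fun _ => isOpen_interior)
    fun j => dense_interior_exists_le_Dq hK j.2.2 (hpos j.1)
  have hCd : Dense (⋂ q, C q) := dense_iInter_of_isOpen (fun _ => isOpen_interior)
    fun q => dense_interior_upperDim_le hK q.2
  refine ⟨(⋂ n, A n) ∩ (⋂ j, B j) ∩ ⋂ q, C q, ?_,
    (hAd.inter_of_Gδ hAG hBG hBd).inter_of_Gδ (hAG.inter hBG) hCG hCd, (hAG.inter hBG).inter hCG⟩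
  rintro μ ⟨⟨hμA, hμB⟩, hμC⟩
  refine ⟨lowerDim_one_eq_zero (μ : Measure K) fun n => ?_, ?_, ?_⟩
  · have h := interior_subset (mem_iInter.1 hμA n)
    exact h
  · refine le_of_forall_lt fun a ha => ?_
    obtain ⟨q, haq, hq⟩ := EReal.lt_iff_exists_rat_btwn.1 ha
    have hfreq : ∃ᶠ r in 𝓝[>] (0 : ℝ), ((q : ℝ) : EReal) ≤ ((Dq (μ : Measure K) r 1 : ℝ) : EReal) :=
      frequently_nhdsGT_zero fun n => by
        obtain ⟨r, hr, hrn, hD⟩ := interior_subset (mem_iInter.1 hμB (n, ⟨q, hq⟩))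
        exact ⟨r, hr, hrn, by exact_mod_cast hD⟩
    exact haq.trans_le (le_limsup_of_frequently_le hfreq (by isBoundedDefault))
  · refine le_of_forall_gt fun a ha => ?_
    obtain ⟨q, hq, hqa⟩ := EReal.lt_iff_exists_rat_btwn.1 ha
    have h := interior_subset (mem_iInter.1 hμC ⟨q, hq⟩)
    exact lt_of_le_of_lt h hqa
end
end

section
/- Let N ≥ 2 and let S_1,…,S_N be contracting similarities of ℝ^d with ratios r_1,…,r_N ∈ (0,1), and let K be the associated self-similar compact set (the unique nonempty compact set with K = ⋃_i S_i(K)). If S_i(K) ∩ S_j(K) = ∅ for all i ≠ j (the strong separation condition), then bsi(K) = dim_H(K) = dim̲_B(K) = dim̄_B(K) = β, where β is the unique solution of Σ_{i=1}^N r_i^β = 1. -/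
open MeasureTheory Filter Metric Set Topology

noncomputable section

/-- A self-similar compact set satisfying the strong separation condition. -/
structure IsSeparatedSelfSimilar {X : Type*} [MetricSpace X] {N : ℕ} (S : Fin N → X → X)
    (r : Fin N → ℝ) (K : Set X) : Prop where
  ratio_mem : ∀ i, r i ∈ Set.Ioo (0 : ℝ) 1
  dist_map : ∀ i x y, dist (S i x) (S i y) = r i * dist x y
  isCompact : IsCompact K
  nonempty : K.Nonempty
  eq_iUnion : K = ⋃ i, S i '' K
  disjoint : ∀ i j, i ≠ j → Disjoint (S i '' K) (S j '' K)

/-- Positive weights of total mass one are the lengths of intervals tiling `[0, 1]`. -/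
theorem exists_tiling_Icc {N : ℕ} (p : Fin N → ℝ) (hp : ∀ i, 0 < p i) (hsum : ∑ i, p i = 1) :
    ∃ a : Fin N → ℝ, (∀ i, 0 ≤ a i ∧ a i + p i ≤ 1) ∧
      ∀ t ∈ Set.Icc (0 : ℝ) 1, ∃ i, a i ≤ t ∧ t ≤ a i + p i := by
  classical
  set q : ℕ → ℝ := fun k => if h : k < N then p ⟨k, h⟩ else 0 with hq
  have hqp : ∀ i : Fin N, q i = p i := fun i => by simp [hq]
  have hq0 : ∀ k, 0 ≤ q k := fun k => by
    simp only [hq]; split_ifs with h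
    · exact (hp _).le
    · exact le_rfl
  have hN : ∑ k ∈ Finset.range N, q k = 1 := by
    rw [Finset.sum_range, ← hsum]; exact Finset.sum_congr rfl fun i _ => hqp i
  have hNpos : 0 < N := by
    rcases Nat.eq_zero_or_pos N with h | h
    · subst h; simp at hN
    · exact h
  refine ⟨fun i => ∑ k ∈ Finset.range i, q k, fun i => ⟨Finset.sum_nonneg fun k _ => hq0 k, ?_⟩, ?_⟩
  · rw [← hqp i, ← Finset.sum_range_succ, ← hN]
    exact Finset.sum_le_sum_of_subset_of_nonneg
      (Finset.range_mono (Nat.succ_le_of_lt i.2)) fun k _ _ => hq0 k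
  · intro t ht
    have hex : ∃ n, t ≤ ∑ k ∈ Finset.range n, q k := ⟨N, by rw [hN]; exact ht.2⟩
    have hfind := Nat.find_spec hex
    have hle : Nat.find hex ≤ N := Nat.find_min' hex (by rw [hN]; exact ht.2)
    rcases hn : Nat.find hex with _ | m
    · rw [hn] at hfind
      simp only [Finset.range_zero, Finset.sum_empty] at hfind
      refine ⟨⟨0, hNpos⟩, by simpa using ht.1, ?_⟩
      simpa using hfind.trans (hp _).le
    · have hm : m < N := by omega
      refine ⟨⟨m, hm⟩, ?_, ?_⟩
      · have := Nat.find_min hex (m := m) (by omega)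
        exact (not_le.mp this).le
      · rw [← hqp, ← Finset.sum_range_succ, ← hn]; exact hfind

/-- If `u` differs from `β L` by a bounded amount and `L → ∞`, then `u / L → β`. -/
theorem tendsto_div_of_affine_bounds {α : Type*} {l : Filter α} {u L : α → ℝ} {β c₁ c₂ : ℝ}
    (hL : Tendsto L l atTop) (h₁ : ∀ᶠ x in l, β * L x + c₁ ≤ u x)
    (h₂ : ∀ᶠ x in l, u x ≤ β * L x + c₂) : Tendsto (fun x => u x / L x) l (𝓝 β) := by
  have key : ∀ c : ℝ, Tendsto (fun x => β + c / L x) l (𝓝 β) := fun c => by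
    simpa using (tendsto_const_nhds (x := β)).add (hL.const_div_atTop c)
  refine tendsto_of_tendsto_of_tendsto_of_le_of_le' (key c₁) (key c₂) ?_ ?_
  · filter_upwards [h₁, hL.eventually_gt_atTop 0] with x hx h0
    rw [le_div_iff₀ h0, add_mul, div_mul_cancel₀ _ h0.ne']; exact hx
  · filter_upwards [h₂, hL.eventually_gt_atTop 0] with x hx h0
    rw [div_le_iff₀ h0, add_mul, div_mul_cancel₀ _ h0.ne']; exact hx

theorem exponent_pos {N : ℕ} (hN : 2 ≤ N) {r : Fin N → ℝ} (hr : ∀ i, r i ∈ Set.Ioo (0 : ℝ) 1)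
    {β : ℝ} (hβ : ∑ i, r i ^ β = 1) : 0 < β := by
  by_contra! h
  have : ∑ _i : Fin N, (1 : ℝ) ≤ ∑ i, r i ^ β := Finset.sum_le_sum fun i _ =>
    Real.one_le_rpow_of_pos_of_le_one_of_nonpos (hr i).1 (hr i).2.le h
  rw [hβ] at this
  simp only [Finset.sum_const, Finset.card_univ, Fintype.card_fin, nsmul_eq_mul, mul_one] at this
  have h2 : (2 : ℝ) ≤ N := by exact_mod_cast hN
  linarith

namespace IsSeparatedSelfSimilar

variable {X : Type*} [MetricSpace X] {N : ℕ} {S : Fin N → X → X} {r : Fin N → ℝ} {K : Set X}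

theorem map_mem (h : IsSeparatedSelfSimilar S r K) (i : Fin N) {x : X} (hx : x ∈ K) :
    S i x ∈ K := by
  rw [h.eq_iUnion]; exact mem_iUnion.2 ⟨i, x, hx, rfl⟩

theorem exists_preimage (h : IsSeparatedSelfSimilar S r K) {x : X} (hx : x ∈ K) :
    ∃ i, ∃ y ∈ K, S i y = x := by
  rw [h.eq_iUnion] at hx
  exact mem_iUnion.1 hx

theorem injective (h : IsSeparatedSelfSimilar S r K) (i : Fin N) : Function.Injective (S i) := by
  intro x y hxy
  have h1 := h.dist_map i x y
  rw [hxy, dist_self] at h1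
  exact dist_eq_zero.1 ((mul_eq_zero.1 h1.symm).resolve_left (h.ratio_mem i).1.ne')

theorem index_unique (h : IsSeparatedSelfSimilar S r K) {i j : Fin N} {x y : X} (hx : x ∈ K)
    (hy : y ∈ K) (hxy : S i x = S j y) : i = j := by
  by_contra hij
  exact disjoint_left.1 (h.disjoint i j hij) ⟨x, hx, rfl⟩ ⟨y, hy, hxy.symm⟩

theorem fin_nonempty (h : IsSeparatedSelfSimilar S r K) : Nonempty (Fin N) :=
  let ⟨_, hx⟩ := h.nonempty
  let ⟨i, _⟩ := h.exists_preimage hx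
  ⟨i⟩

theorem exists_ratio_le (h : IsSeparatedSelfSimilar S r K) :
    ∃ b : ℝ, 0 < b ∧ b < 1 ∧ ∀ i, r i ≤ b := by
  have := h.fin_nonempty
  obtain ⟨i, hi⟩ := Finite.exists_max r
  exact ⟨r i, (h.ratio_mem i).1, (h.ratio_mem i).2, hi⟩

theorem exists_le_ratio (h : IsSeparatedSelfSimilar S r K) :
    ∃ b : ℝ, 0 < b ∧ b < 1 ∧ ∀ i, b ≤ r i := by
  have := h.fin_nonempty
  obtain ⟨i, hi⟩ := Finite.exists_min r
  exact ⟨r i, (h.ratio_mem i).1, (h.ratio_mem i).2, hi⟩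

theorem exists_gap (h : IsSeparatedSelfSimilar S r K) :
    ∃ ε : ℝ, 0 < ε ∧ ∀ i j, i ≠ j → ∀ x ∈ K, ∀ y ∈ K, ε ≤ dist (S i x) (S j y) := by
  have := h.fin_nonempty
  have hc : ∀ i, IsCompact (S i '' K) := fun i => h.isCompact.image <|
    (LipschitzWith.of_dist_le_mul (K := ⟨r i, (h.ratio_mem i).1.le⟩)
      fun x y => (h.dist_map i x y).le).continuous
  have hpair : ∀ q : Fin N × Fin N, ∃ ε : ℝ, 0 < ε ∧
      (q.1 ≠ q.2 → ∀ x ∈ K, ∀ y ∈ K, ε ≤ dist (S q.1 x) (S q.2 y)) := by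
    intro q
    by_cases hq : q.1 = q.2
    · exact ⟨1, one_pos, fun h' => (h' hq).elim⟩
    · obtain ⟨ε, hε, hle⟩ := Metric.exists_pos_forall_lt_edist (hc q.1) (hc q.2).isClosed
        (h.disjoint _ _ hq)
      refine ⟨ε, hε, fun _ x hx y hy => ?_⟩
      have := hle _ ⟨x, hx, rfl⟩ _ ⟨y, hy, rfl⟩
      rw [edist_nndist] at this
      exact_mod_cast this.le
  choose ε hε hle using hpair
  obtain ⟨q, hq⟩ := Finite.exists_min ε
  exact ⟨ε q, hε q, fun i j hij x hx y hy => (hq (i, j)).trans (hle (i, j) hij x hx y hy)⟩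

/-- The distribution function of the self-similar measure with weights `p`. -/
theorem exists_distribution (h : IsSeparatedSelfSimilar S r K) (p a : Fin N → ℝ)
    (hp : ∀ i, 0 < p i) (ha : ∀ i, 0 ≤ a i ∧ a i + p i ≤ 1) :
    ∃ f : X → ℝ, (∀ x ∈ K, f x ∈ Set.Icc (0 : ℝ) 1) ∧
      ∀ i, ∀ x ∈ K, f (S i x) = a i + p i * f x := by
  have := h.fin_nonempty
  have : Nonempty X := ⟨h.nonempty.some⟩
  choose! ι σ hσK hσ using fun x (hx : x ∈ K) => h.exists_preimage hx
  let s : ℕ → X → ℝ := fun n => Nat.rec (fun _ => 0) (fun _ g x => a (ι x) + p (ι x) * g (σ x)) n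
  have hs : ∀ n x, s (n + 1) x = a (ι x) + p (ι x) * s n (σ x) := fun n x => rfl
  have hs01 : ∀ n, ∀ x ∈ K, s n x ∈ Set.Icc (0 : ℝ) 1 := by
    intro n
    induction n with
    | zero => intro x _; exact ⟨le_rfl, zero_le_one⟩
    | succ n ih =>
      intro x hx
      obtain ⟨h0, h1⟩ := ih _ (hσK x hx)
      rw [hs]
      have := hp (ι x)
      constructor
      · have := (ha (ι x)).1; positivity
      · nlinarith [(ha (ι x)).2]
  have hmono : ∀ n, ∀ x ∈ K, s n x ≤ s (n + 1) x := by
    intro n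
    induction n with
    | zero => intro x hx; exact (hs01 1 x hx).1
    | succ n ih =>
      intro x hx
      rw [hs, hs (n + 1)]
      have := ih _ (hσK x hx)
      have := (hp (ι x)).le
      gcongr
  have hlim : ∀ x ∈ K, Tendsto (fun n => s n x) atTop (𝓝 (⨆ n, s n x)) := fun x hx =>
    tendsto_atTop_ciSup (monotone_nat_of_le_succ fun n => hmono n x hx)
      ⟨1, by rintro _ ⟨n, rfl⟩; exact (hs01 n x hx).2⟩
  refine ⟨fun x => ⨆ n, s n x, fun x hx => ?_, fun i x hx => ?_⟩
  · exact isClosed_Icc.mem_of_tendsto (hlim x hx) (Eventually.of_forall fun n => hs01 n x hx)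
  · have hSx := h.map_mem i hx
    have hι : ι (S i x) = i := h.index_unique (hσK _ hSx) hx (hσ _ hSx)
    have hσx : σ (S i x) = x := h.injective i (by have := hσ _ hSx; rwa [hι] at this)
    refine tendsto_nhds_unique ((tendsto_add_atTop_iff_nat 1).2 (hlim _ hSx)) ?_
    have : (fun n => s (n + 1) (S i x)) = fun n => a i + p i * s n x := by
      funext n; rw [hs, hι, hσx]
    rw [this]
    exact ((hlim x hx).const_mul _).const_add _

/-- Distinct points of `K` lie in well separated clopen pieces, at a scale controlling the
oscillation of the distribution function. -/
theorem exists_separating_piece (h : IsSeparatedSelfSimilar S r K) {β : ℝ} {a : Fin N → ℝ}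
    {f : X → ℝ} (hf : ∀ x ∈ K, f x ∈ Set.Icc (0 : ℝ) 1)
    (hfS : ∀ i, ∀ x ∈ K, f (S i x) = a i + r i ^ β * f x) {ε : ℝ} (hε : 0 < ε)
    (hgap : ∀ i j, i ≠ j → ∀ x ∈ K, ∀ y ∈ K, ε ≤ dist (S i x) (S j y)) {x y : X}
    (hx : x ∈ K) (hy : y ∈ K) (hxy : x ≠ y) :
    ∃ A ⊆ K, x ∈ A ∧ y ∉ A ∧ ∃ ρ : ℝ, 0 < ρ ∧ ρ ≤ 1 ∧ |f x - f y| ≤ ρ ^ β ∧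
      ∀ u ∈ A, ∀ v ∈ K \ A, ε * ρ ≤ dist u v := by
  obtain ⟨b, hb0, hb1, hb⟩ := h.exists_ratio_le
  set R := Metric.diam K + 1
  have hR : 0 < R := by have : 0 ≤ Metric.diam K := Metric.diam_nonneg; positivity
  obtain ⟨n, hn⟩ : ∃ n : ℕ, R * b ^ n < dist x y := by
    obtain ⟨n, hn⟩ := exists_pow_lt_of_lt_one (div_pos (dist_pos.2 hxy) hR) hb1
    exact ⟨n, by rwa [lt_div_iff₀' hR] at hn⟩
  clear hxy
  induction n generalizing x y with
  | zero =>
    have := Metric.dist_le_diam_of_mem h.isCompact.isBounded hx hy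
    simp only [pow_zero, mul_one, R] at hn
    linarith
  | succ n ih =>
    obtain ⟨i, x, hx', rfl⟩ := h.exists_preimage hx
    obtain ⟨j, y, hy', rfl⟩ := h.exists_preimage hy
    by_cases hij : i = j
    · subst hij
      have hri := h.ratio_mem i
      have hlt : R * b ^ n < dist x y := by
        rw [h.dist_map] at hn
        have h1 : r i * dist x y ≤ b * dist x y := by gcongr; exact hb i
        have h2 : b * (R * b ^ n) < b * dist x y := by
          calc b * (R * b ^ n) = R * b ^ (n + 1) := by ring
            _ < _ := hn.trans_le h1
        exact lt_of_mul_lt_mul_left h2 hb0.le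
      obtain ⟨A, hAK, hxA, hyA, ρ, hρ, hρ1, hosc, hsep⟩ := ih hx' hy' hlt
      refine ⟨S i '' A, ?_, ⟨x, hxA, rfl⟩, ?_, r i * ρ, mul_pos hri.1 hρ, ?_, ?_, ?_⟩
      · rintro _ ⟨z, hz, rfl⟩; exact h.map_mem i (hAK hz)
      · rwa [(h.injective i).mem_set_image]
      · nlinarith [hri.1, hri.2]
      · rw [hfS i x hx', hfS i y hy', Real.mul_rpow hri.1.le hρ.le]
        have h0 : 0 ≤ r i ^ β := Real.rpow_nonneg hri.1.le _
        rw [show a i + r i ^ β * f x - (a i + r i ^ β * f y) = r i ^ β * (f x - f y) by ring,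
          abs_mul, abs_of_nonneg h0]
        gcongr
      · rintro _ ⟨u, hu, rfl⟩ v ⟨hvK, hvA⟩
        obtain ⟨k, v, hv, rfl⟩ := h.exists_preimage hvK
        by_cases hik : i = k
        · subst hik
          rw [h.dist_map]
          have hvA' : v ∉ A := fun hvA' => hvA ⟨v, hvA', rfl⟩
          have := hsep u hu v ⟨hv, hvA'⟩
          nlinarith [hri.1]
        · refine le_trans ?_ (hgap i k hik u (hAK hu) v hv)
          have : r i * ρ ≤ 1 := by nlinarith [hri.1, hri.2]
          nlinarith
    · refine ⟨S i '' K, ?_, ⟨x, hx', rfl⟩, ?_, 1, one_pos, le_rfl, ?_, ?_⟩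
      · rintro _ ⟨z, hz, rfl⟩; exact h.map_mem i hz
      · rintro ⟨z, hz, hzy⟩; exact hij (h.index_unique hz hy' hzy)
      · rw [Real.one_rpow, abs_sub_le_iff]
        have h1 := hf _ hx
        have h2 := hf _ hy
        constructor <;> linarith [h1.1, h1.2, h2.1, h2.2]
      · rintro _ ⟨u, hu, rfl⟩ v ⟨hvK, hvA⟩
        obtain ⟨k, v, hv, rfl⟩ := h.exists_preimage hvK
        rw [mul_one]
        refine hgap i k ?_ u hu v hv
        rintro rfl
        exact hvA ⟨v, hv, rfl⟩

/-- The distribution function takes a dense set of values in `[0, 1]`. -/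
theorem Icc_subset_closure_image (h : IsSeparatedSelfSimilar S r K) {p a : Fin N → ℝ}
    (hp : ∀ i, 0 < p i ∧ p i < 1)
    (hcov : ∀ t ∈ Set.Icc (0 : ℝ) 1, ∃ i, a i ≤ t ∧ t ≤ a i + p i) {f : X → ℝ}
    (hf : ∀ x ∈ K, f x ∈ Set.Icc (0 : ℝ) 1) (hfS : ∀ i, ∀ x ∈ K, f (S i x) = a i + p i * f x) :
    Set.Icc (0 : ℝ) 1 ⊆ closure (f '' K) := by
  have := h.fin_nonempty
  obtain ⟨m, hm⟩ := Finite.exists_max p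
  have key : ∀ n : ℕ, ∀ t ∈ Set.Icc (0 : ℝ) 1, ∃ x ∈ K, |t - f x| ≤ p m ^ n := by
    intro n
    induction n with
    | zero =>
      intro t ht
      obtain ⟨x, hx⟩ := h.nonempty
      have := hf x hx
      refine ⟨x, hx, ?_⟩
      rw [pow_zero, abs_sub_le_iff]
      constructor <;> linarith [ht.1, ht.2, this.1, this.2]
    | succ n ih =>
      intro t ht
      obtain ⟨i, hi1, hi2⟩ := hcov t ht
      have hpi := (hp i).1
      obtain ⟨x, hx, hle⟩ := ih ((t - a i) / p i)
        ⟨div_nonneg (by linarith) hpi.le, (div_le_one hpi).2 (by linarith)⟩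
      refine ⟨S i x, h.map_mem i hx, ?_⟩
      have heq : t - f (S i x) = p i * ((t - a i) / p i - f x) := by
        rw [hfS i x hx]; field_simp; ring
      rw [heq, abs_mul, abs_of_pos hpi, pow_succ']
      have := hm i
      have := (hp m).1.le
      gcongr
  intro t ht
  rw [Metric.mem_closure_iff]
  intro e he
  obtain ⟨n, hn⟩ := exists_pow_lt_of_lt_one he (hp m).2
  obtain ⟨x, hx, hle⟩ := key n t ht
  exact ⟨f x, ⟨x, hx, rfl⟩, by rw [Real.dist_eq]; exact hle.trans_lt hn⟩

/-- `K` carries a function onto `[0, 1]` whose oscillation is controlled by the separation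
of points in `K`. -/
theorem exists_surjective_holder (h : IsSeparatedSelfSimilar S r K) {β : ℝ} (hβ0 : 0 < β)
    (hβ : ∑ i, r i ^ β = 1) :
    ∃ f : X → ℝ, ∃ ε : ℝ, 0 < ε ∧ f '' K = Set.Icc 0 1 ∧
      (∀ x ∈ K, ∀ y ∈ K, x ≠ y → ∃ A ⊆ K, x ∈ A ∧ y ∉ A ∧ ∃ ρ : ℝ, 0 < ρ ∧
        |f x - f y| ≤ ρ ^ β ∧ ∀ u ∈ A, ∀ v ∈ K \ A, ε * ρ ≤ dist u v) ∧
      ∀ x ∈ K, ∀ y ∈ K, |f x - f y| ≤ (dist x y / ε) ^ β := by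
  have hp : ∀ i, 0 < r i ^ β ∧ r i ^ β < 1 := fun i =>
    ⟨Real.rpow_pos_of_pos (h.ratio_mem i).1 _,
      Real.rpow_lt_one (h.ratio_mem i).1.le (h.ratio_mem i).2 hβ0⟩
  obtain ⟨a, ha, hcov⟩ := exists_tiling_Icc (fun i => r i ^ β) (fun i => (hp i).1) hβ
  obtain ⟨f, hf, hfS⟩ := h.exists_distribution (fun i => r i ^ β) a (fun i => (hp i).1) ha
  obtain ⟨ε, hε, hgap⟩ := h.exists_gap
  have hsepa : ∀ x ∈ K, ∀ y ∈ K, x ≠ y → ∃ A ⊆ K, x ∈ A ∧ y ∉ A ∧ ∃ ρ : ℝ, 0 < ρ ∧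
        |f x - f y| ≤ ρ ^ β ∧ ∀ u ∈ A, ∀ v ∈ K \ A, ε * ρ ≤ dist u v := by
    intro x hx y hy hxy
    obtain ⟨A, hAK, hxA, hyA, ρ, hρ, -, h1, h2⟩ :=
      h.exists_separating_piece hf hfS hε hgap hx hy hxy
    exact ⟨A, hAK, hxA, hyA, ρ, hρ, h1, h2⟩
  have hhol : ∀ x ∈ K, ∀ y ∈ K, |f x - f y| ≤ (dist x y / ε) ^ β := by
    intro x hx y hy
    by_cases hxy : x = y
    · subst hxy; simp [Real.zero_rpow hβ0.ne']
    · obtain ⟨A, hAK, hxA, hyA, ρ, hρ, h1, h2⟩ := hsepa x hx y hy hxy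
      refine h1.trans (Real.rpow_le_rpow hρ.le ?_ hβ0.le)
      rw [le_div_iff₀' hε]
      exact h2 x hxA y ⟨hy, hyA⟩
  refine ⟨f, ε, hε, ?_, hsepa, hhol⟩
  have hcont : ContinuousOn f K := by
    intro x hx
    rw [ContinuousWithinAt, tendsto_iff_dist_tendsto_zero]
    have hlim : Tendsto (fun y => (dist y x / ε) ^ β) (𝓝[K] x) (𝓝 0) := by
      have : Continuous fun y => (dist y x / ε) ^ β :=
        (by fun_prop : Continuous fun y => dist y x / ε).rpow_const fun _ => Or.inr hβ0.le
      have := this.tendsto x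
      simp only [dist_self, zero_div, Real.zero_rpow hβ0.ne'] at this
      exact this.mono_left nhdsWithin_le_nhds
    refine squeeze_zero' (Eventually.of_forall fun _ => dist_nonneg) ?_ hlim
    filter_upwards [self_mem_nhdsWithin] with y hy
    rw [Real.dist_eq]; exact hhol y hy x hx
  apply Subset.antisymm
  · rintro _ ⟨x, hx, rfl⟩; exact hf x hx
  · have := h.Icc_subset_closure_image hp hcov hf hfS
    rwa [(h.isCompact.image_of_continuousOn hcont).isClosed.closure_eq] at this

/-- `K` is covered by at most `(C / δ) ^ β` balls of radius `δ`. -/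
theorem exists_finset_cover (h : IsSeparatedSelfSimilar S r K) {β : ℝ} (hβ0 : 0 < β)
    (hβ : ∑ i, r i ^ β = 1) :
    ∃ C : ℝ, 1 ≤ C ∧ ∀ δ : ℝ, 0 < δ → δ ≤ C →
      ∃ s : Finset X, (s.card : ℝ) ≤ (C / δ) ^ β ∧ K ⊆ ⋃ x ∈ s, ball x δ := by
  classical
  obtain ⟨b, hb0, hb1, hb⟩ := h.exists_ratio_le
  obtain ⟨m, hm0, hm1, hm⟩ := h.exists_le_ratio
  set R := Metric.diam K + 1 with hRdef
  have hR1 : 1 ≤ R := by have : 0 ≤ Metric.diam K := Metric.diam_nonneg; linarith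
  have hR : 0 < R := by linarith
  have hRC : R ≤ R / m := by rw [le_div_iff₀ hm0]; nlinarith
  refine ⟨R / m, hR1.trans hRC, ?_⟩
  have hbig : ∀ δ : ℝ, R < δ → δ ≤ R / m →
      ∃ s : Finset X, (s.card : ℝ) ≤ (R / m / δ) ^ β ∧ K ⊆ ⋃ x ∈ s, ball x δ := by
    intro δ hδ hδ'
    obtain ⟨x, hx⟩ := h.nonempty
    refine ⟨{x}, ?_, fun y hy => ?_⟩
    · simp only [Finset.card_singleton, Nat.cast_one]
      exact Real.one_le_rpow ((one_le_div (hR.trans hδ)).2 hδ') hβ0.le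
    · have := Metric.dist_le_diam_of_mem h.isCompact.isBounded hy hx
      simp only [Finset.mem_singleton, iUnion_iUnion_eq_left, mem_ball]
      linarith
  have key : ∀ n : ℕ, ∀ δ : ℝ, R * b ^ n < δ → δ ≤ R / m →
      ∃ s : Finset X, (s.card : ℝ) ≤ (R / m / δ) ^ β ∧ K ⊆ ⋃ x ∈ s, ball x δ := by
    intro n
    induction n with
    | zero => intro δ hδ hδ'; exact hbig δ (by simpa using hδ) hδ'
    | succ n ih =>
      intro δ hδ hδ'
      rcases lt_or_ge R δ with hlt | hge
      · exact hbig δ hlt hδ'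
      have hδ0 : 0 < δ := lt_trans (by positivity) hδ
      have hstep : ∀ i, ∃ s : Finset X, (s.card : ℝ) ≤ (R / m / (δ / r i)) ^ β ∧
          K ⊆ ⋃ x ∈ s, ball x (δ / r i) := by
        intro i
        have hri := (h.ratio_mem i).1
        refine ih _ ?_ ?_
        · rw [lt_div_iff₀ hri]
          calc R * b ^ n * r i ≤ R * b ^ n * b := by gcongr; exact hb i
            _ = R * b ^ (n + 1) := by ring
            _ < δ := hδ
        · exact div_le_div₀ hR.le hge hm0 (hm i)
      choose s hs hcov using hstep
      refine ⟨Finset.univ.biUnion fun i => (s i).image (S i), ?_, ?_⟩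
      · have h1 : ((Finset.univ.biUnion fun i => (s i).image (S i)).card : ℝ)
            ≤ ∑ i, ((s i).card : ℝ) := by
          exact_mod_cast Finset.card_biUnion_le.trans
            (Finset.sum_le_sum fun i _ => Finset.card_image_le)
        refine h1.trans ((Finset.sum_le_sum fun i _ => hs i).trans_eq ?_)
        have h2 : ∀ i, (R / m / (δ / r i)) ^ β = (R / m / δ) ^ β * r i ^ β := by
          intro i
          rw [← Real.mul_rpow (by positivity) (h.ratio_mem i).1.le]
          congr 1
          have := (h.ratio_mem i).1
          field_simp
        simp_rw [h2]
        rw [← Finset.mul_sum, hβ, mul_one]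
      · intro x hx
        obtain ⟨i, y, hy, rfl⟩ := h.exists_preimage hx
        have := hcov i hy
        simp only [mem_iUnion, exists_prop, mem_ball] at this
        obtain ⟨z, hz, hyz⟩ := this
        simp only [mem_iUnion, exists_prop, mem_ball]
        refine ⟨S i z, Finset.mem_biUnion.2 ⟨i, Finset.mem_univ _, Finset.mem_image_of_mem _ hz⟩, ?_⟩
        rw [h.dist_map]
        rwa [lt_div_iff₀' (h.ratio_mem i).1] at hyz
  intro δ hδ hδ'
  obtain ⟨n, hn⟩ := exists_pow_lt_of_lt_one (div_pos hδ hR) hb1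
  exact key n δ (by rwa [lt_div_iff₀' hR] at hn) hδ'

end IsSeparatedSelfSimilar

/-- If `f` maps `K` onto `[0, 1]` and `K` is covered by finitely many sets on which `f`
oscillates by at most `η`, then there are at least `1 / η` of them. -/
theorem one_le_card_mul_of_oscillation {X ι : Type*} [Fintype ι] {K : Set X} {f : X → ℝ}
    (hf : f '' K = Set.Icc 0 1) {V : ι → Set X} (hV : K ⊆ ⋃ i, V i) {η : ℝ}
    (hosc : ∀ i, ∀ x ∈ V i ∩ K, ∀ y ∈ V i ∩ K, |f x - f y| ≤ η) :
    1 ≤ (Fintype.card ι : ℝ) * η := by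
  have hsub : Set.Icc (0 : ℝ) 1 ⊆ ⋃ i, f '' (V i ∩ K) := by
    rw [← hf]
    rintro _ ⟨x, hx, rfl⟩
    obtain ⟨i, hi⟩ := mem_iUnion.1 (hV hx)
    exact mem_iUnion.2 ⟨i, x, ⟨hi, hx⟩, rfl⟩
  have hvol : ∀ i, volume (f '' (V i ∩ K)) ≤ ENNReal.ofReal η := by
    intro i
    refine (Real.volume_le_diam _).trans (ediam_le ?_)
    rintro _ ⟨x, hx, rfl⟩ _ ⟨y, hy, rfl⟩
    rw [edist_dist, Real.dist_eq]
    exact ENNReal.ofReal_le_ofReal (hosc i x hx y hy)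
  have h1 : (1 : ENNReal) ≤ Fintype.card ι * ENNReal.ofReal η := by
    calc (1 : ENNReal) = volume (Set.Icc (0 : ℝ) 1) := by simp
      _ ≤ volume (⋃ i, f '' (V i ∩ K)) := measure_mono hsub
      _ ≤ ∑ i, volume (f '' (V i ∩ K)) := measure_iUnion_fintype_le _ _
      _ ≤ ∑ _i : ι, ENNReal.ofReal η := Finset.sum_le_sum fun i _ => hvol i
      _ = _ := by simp
  rw [← ENNReal.ofReal_natCast, ← ENNReal.ofReal_mul (Nat.cast_nonneg _)] at h1
  exact ENNReal.one_le_ofReal.1 h1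

/-- A logarithmic form of `1 ≤ n (c δ) ^ β`. -/
theorem log_lower_bound {n c δ β : ℝ} (hn : 0 ≤ n) (hc : 0 < c) (hδ : 0 < δ)
    (h : 1 ≤ n * (c * δ) ^ β) : β * (-Real.log δ) + -(β * Real.log c) ≤ Real.log n := by
  have hp : 0 < (c * δ) ^ β := Real.rpow_pos_of_pos (mul_pos hc hδ) _
  have hn0 : n ≠ 0 := by rintro rfl; simp at h; linarith
  have := Real.log_nonneg h
  rw [Real.log_mul hn0 hp.ne', Real.log_rpow (mul_pos hc hδ), Real.log_mul hc.ne' hδ.ne'] at this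
  linarith

/-- A logarithmic form of `n ≤ M (C / δ) ^ β`. -/
theorem log_upper_bound {n M C δ β : ℝ} (hn : 0 < n) (hM : 0 < M) (hC : 0 < C) (hδ : 0 < δ)
    (h : n ≤ M * (C / δ) ^ β) :
    Real.log n ≤ β * (-Real.log δ) + (Real.log M + β * Real.log C) := by
  have hp : 0 < (C / δ) ^ β := Real.rpow_pos_of_pos (div_pos hC hδ) _
  refine (Real.log_le_log hn h).trans_eq ?_
  rw [Real.log_mul hM.ne' hp.ne', Real.log_rpow (div_pos hC hδ), Real.log_div hC.ne' hδ.ne']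
  ring

theorem exists_fin_cover {X : Type*} [MetricSpace X] {K : Set X} {δ : ℝ} {s : Finset X}
    (hs : K ⊆ ⋃ x ∈ s, ball x δ) : ∃ c : Fin s.card → X, K ⊆ ⋃ i, ball (c i) δ := by
  refine ⟨fun i => s.equivFin.symm i, fun x hx => ?_⟩
  have := hs hx
  simp only [mem_iUnion, exists_prop] at this ⊢
  obtain ⟨y, hy, hxy⟩ := this
  exact ⟨s.equivFin ⟨y, hy⟩, by simpa using hxy⟩

namespace IsSeparatedSelfSimilar

variable {X : Type*} [MetricSpace X] {N : ℕ} {S : Fin N → X → X} {r : Fin N → ℝ} {K : Set X}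

theorem tendsto_log_coveringNumber (h : IsSeparatedSelfSimilar S r K) {β : ℝ} (hβ0 : 0 < β)
    (hβ : ∑ i, r i ^ β = 1) :
    Tendsto (fun δ : ℝ => Real.log (coveringNumber K δ : ℝ) / (-Real.log δ)) (𝓝[>] (0 : ℝ))
      (𝓝 β) := by
  obtain ⟨C, hC, hcov⟩ := h.exists_finset_cover hβ0 hβ
  obtain ⟨f, ε, hε, hf, -, hhol⟩ := h.exists_surjective_holder hβ0 hβ
  have hsmall : ∀ᶠ δ : ℝ in 𝓝[>] (0 : ℝ), 0 < δ ∧ δ ≤ C := by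
    filter_upwards [Ioo_mem_nhdsGT (zero_lt_one.trans_le hC)] with δ hδ using ⟨hδ.1, hδ.2.le⟩
  have hlow : ∀ δ : ℝ, 0 < δ → δ ≤ C → 1 ≤ (coveringNumber K δ : ℝ) * (2 / ε * δ) ^ β := by
    intro δ hδ hδC
    obtain ⟨s, -, hs⟩ := hcov δ hδ hδC
    have hne : {n : ℕ | ∃ c : Fin n → X, K ⊆ ⋃ i, ball (c i) δ}.Nonempty :=
      ⟨_, exists_fin_cover hs⟩
    obtain ⟨c, hc⟩ := Nat.sInf_mem hne
    have := one_le_card_mul_of_oscillation hf hc (η := (2 / ε * δ) ^ β) ?_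
    · rwa [Fintype.card_fin] at this
    · intro i x hx y hy
      refine (hhol x hx.2 y hy.2).trans (Real.rpow_le_rpow (by positivity) ?_ hβ0.le)
      have hx1 := mem_ball.1 hx.1
      have hy1 := mem_ball'.1 hy.1
      have : dist x y ≤ 2 * δ := by linarith [dist_triangle x (c i) y]
      calc dist x y / ε ≤ 2 * δ / ε := by gcongr
        _ = 2 / ε * δ := by ring
  refine tendsto_div_of_affine_bounds
    (tendsto_neg_atBot_atTop.comp Real.tendsto_log_nhdsGT_zero) ?_ ?_
    (c₁ := -(β * Real.log (2 / ε))) (c₂ := Real.log 1 + β * Real.log C)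
  · filter_upwards [hsmall] with δ hδ
    exact log_lower_bound (Nat.cast_nonneg _) (by positivity) hδ.1 (hlow δ hδ.1 hδ.2)
  · filter_upwards [hsmall] with δ hδ
    obtain ⟨s, hcard, hs⟩ := hcov δ hδ.1 hδ.2
    have hle : coveringNumber K δ ≤ s.card := Nat.sInf_le (exists_fin_cover hs)
    refine log_upper_bound ?_ one_pos (by linarith) hδ.1 ?_
    · rcases (Nat.cast_nonneg (α := ℝ) (coveringNumber K δ)).lt_or_eq with h0 | h0
      · exact h0
      · have := hlow δ hδ.1 hδ.2
        rw [← h0] at this; linarith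
    · rw [one_mul]; exact le_trans (by exact_mod_cast hle) hcard

theorem dimH_eq (h : IsSeparatedSelfSimilar S r K) {β : ℝ} (hβ0 : 0 < β)
    (hβ : ∑ i, r i ^ β = 1) : dimH K = ENNReal.ofReal β := by
  borelize X
  obtain ⟨C, hC, hcov⟩ := h.exists_finset_cover hβ0 hβ
  obtain ⟨f, ε, hε, hf, -, hhol⟩ := h.exists_surjective_holder hβ0 hβ
  have hC0 : 0 < C := by linarith
  apply le_antisymm
  · have hδ : ∀ n : ℕ, 0 < 1 / ((n : ℝ) + 1) ∧ 1 / ((n : ℝ) + 1) ≤ C := fun n =>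
      ⟨by positivity, ((div_le_one (by positivity)).2 (by simp)).trans hC⟩
    choose s hcard hs using fun n : ℕ => hcov _ (hδ n).1 (hδ n).2
    have hdiam : ∀ n, ∀ x : X,
        ediam (ball x (1 / ((n : ℝ) + 1))) ≤ ENNReal.ofReal (2 * (1 / ((n : ℝ) + 1))) := by
      intro n x
      refine ediam_le fun y hy z hz => ?_
      rw [edist_dist]
      apply ENNReal.ofReal_le_ofReal
      linarith [dist_triangle y x z, mem_ball.1 hy, mem_ball'.1 hz]
    have hfin : μH[β] K ≤ ENNReal.ofReal ((2 * C) ^ β) := by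
      refine (MeasureTheory.Measure.hausdorffMeasure_le_liminf_sum (l := atTop) β K
        (fun n : ℕ => ENNReal.ofReal (2 * (1 / ((n : ℝ) + 1)))) ?_
        (fun n (x : s n) => ball (x : X) (1 / ((n : ℝ) + 1)))
        (Eventually.of_forall fun n x => hdiam n x)
        (Eventually.of_forall fun n => ?_)).trans ?_
      · rw [← ENNReal.ofReal_zero]
        refine ENNReal.tendsto_ofReal ?_
        simpa using (tendsto_one_div_add_atTop_nhds_zero_nat (𝕜 := ℝ)).const_mul 2
      · simpa only [iUnion_subtype] using hs n
      · refine liminf_le_of_le (by isBoundedDefault) fun b hb => ?_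
        obtain ⟨n, hn⟩ := hb.exists
        refine hn.trans ?_
        calc ∑ x : s n, ediam (ball (x : X) (1 / ((n : ℝ) + 1))) ^ β
            ≤ ∑ _x : s n, ENNReal.ofReal (2 * (1 / ((n : ℝ) + 1))) ^ β :=
              Finset.sum_le_sum fun x _ => ENNReal.rpow_le_rpow (hdiam n x) hβ0.le
          _ = ENNReal.ofReal ((s n).card * (2 * (1 / ((n : ℝ) + 1))) ^ β) := by
              rw [ENNReal.ofReal_mul (Nat.cast_nonneg _), ENNReal.ofReal_natCast,
                ENNReal.ofReal_rpow_of_nonneg (by positivity) hβ0.le]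
              simp
          _ ≤ _ := by
              apply ENNReal.ofReal_le_ofReal
              have h1 : 0 ≤ (2 * (1 / ((n : ℝ) + 1))) ^ β := by positivity
              refine (mul_le_mul_of_nonneg_right (hcard n) h1).trans_eq ?_
              rw [← Real.mul_rpow (by positivity) (by positivity)]
              congr 1
              field_simp
    refine dimH_le_of_hausdorffMeasure_ne_top (d := β.toNNReal) ?_
    rw [Real.coe_toNNReal _ hβ0.le]
    exact (hfin.trans_lt ENNReal.ofReal_lt_top).ne
  · have hH : HolderOnWith ((1 / ε) ^ β).toNNReal β.toNNReal f K := by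
      intro x hx y hy
      rw [edist_dist, edist_dist, Real.coe_toNNReal _ hβ0.le,
        ENNReal.ofReal_rpow_of_nonneg dist_nonneg hβ0.le]
      change _ ≤ ENNReal.ofReal _ * _
      rw [← ENNReal.ofReal_mul (by positivity), ← Real.mul_rpow (by positivity) dist_nonneg]
      apply ENNReal.ofReal_le_ofReal
      rw [Real.dist_eq, one_div_mul_eq_div]
      exact hhol x hx y hy
    have hβ' : 0 < β.toNNReal := Real.toNNReal_pos.2 hβ0
    have hle := hH.dimH_image_le hβ'
    have h1 : dimH (f '' K) = 1 := by
      rw [hf, Real.dimH_of_nonempty_interior (by rw [interior_Icc]; simp), Module.finrank_self,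
        Nat.cast_one]
    rw [h1, ENNReal.le_div_iff_mul_le (Or.inl (by exact_mod_cast hβ'.ne'))
      (Or.inl ENNReal.coe_ne_top), one_mul] at hle
    exact hle

end IsSeparatedSelfSimilar

/-- Points of a connected component of a set `H` close to `K` are not separated by a clopen
piece of `K` at large distance from the rest of `K`. -/
theorem gap_le_of_mem_connectedComponentIn {X : Type*} [MetricSpace X] {K H A : Set X}
    {η gap : ℝ} (hH : ∀ z ∈ H, ∃ w ∈ K, dist z w ≤ η)
    (hgap : ∀ u ∈ A, ∀ v ∈ K \ A, gap ≤ dist u v) {x y z : X} (hx : x ∈ A) (hy : y ∈ K \ A)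
    (hη : 0 ≤ η) (hxz : x ∈ connectedComponentIn H z) (hyz : y ∈ connectedComponentIn H z) :
    gap ≤ 2 * η := by
  by_contra! hlt
  have hdisj : Disjoint (thickening (gap / 2) A) (thickening (gap / 2) (K \ A)) := by
    rw [Set.disjoint_left]
    intro w hw hw'
    obtain ⟨u, hu, hwu⟩ := mem_thickening_iff.1 hw
    obtain ⟨v, hv, hwv⟩ := mem_thickening_iff.1 hw'
    linarith [hgap u hu v hv, dist_triangle_left u v w]
  have hsub : connectedComponentIn H z ⊆
      thickening (gap / 2) A ∪ thickening (gap / 2) (K \ A) := by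
    intro w hw
    obtain ⟨u, hu, hwu⟩ := hH w (connectedComponentIn_subset H z hw)
    by_cases huA : u ∈ A
    · exact Or.inl (mem_thickening_iff.2 ⟨u, huA, by linarith⟩)
    · exact Or.inr (mem_thickening_iff.2 ⟨u, ⟨hu, huA⟩, by linarith⟩)
  have hpos : 0 < gap / 2 := by linarith
  have := isPreconnected_connectedComponentIn.subset_left_of_subset_union isOpen_thickening
    isOpen_thickening hdisj hsub ⟨x, hxz, self_subset_thickening hpos _ hx⟩
  exact Set.disjoint_left.1 hdisj (this hyz) (self_subset_thickening hpos _ hy)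

theorem mem_dyadicCube_floor (d n : ℕ) (x : Euc d) :
    x ∈ dyadicCube d n fun j => ⌊2 ^ n * x j⌋ := by
  intro j
  have h2 : (0 : ℝ) < 2 ^ n := by positivity
  rw [div_le_iff₀' h2, lt_div_iff₀' h2]
  exact ⟨Int.floor_le _, Int.lt_floor_add_one _⟩

theorem eq_floor_of_mem_dyadicCube {d n : ℕ} {k : Fin d → ℤ} {x : Euc d}
    (hx : x ∈ dyadicCube d n k) (j : Fin d) : k j = ⌊2 ^ n * x j⌋ := by
  have h2 : (0 : ℝ) < 2 ^ n := by positivity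
  have := hx j
  rw [div_le_iff₀' h2, lt_div_iff₀' h2] at this
  exact (Int.floor_eq_iff.2 this).symm

theorem dist_le_of_mem_dyadicCube {d n : ℕ} {k : Fin d → ℤ} {x y : Euc d}
    (hx : x ∈ dyadicCube d n k) (hy : y ∈ dyadicCube d n k) :
    dist x y ≤ √d * (1 / 2 ^ n) := by
  have hδ : (0 : ℝ) ≤ 1 / 2 ^ n := by positivity
  rw [EuclideanSpace.dist_eq]
  refine (Real.sqrt_le_sqrt (y := d * (1 / 2 ^ n) ^ 2) ?_).trans_eq ?_
  · calc ∑ j, dist (x j) (y j) ^ 2 ≤ ∑ _j : Fin d, (1 / 2 ^ n : ℝ) ^ 2 := by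
          refine Finset.sum_le_sum fun j _ => ?_
          have h1 := hx j
          have h2 := hy j
          rw [add_div] at h1 h2
          have : dist (x j) (y j) ≤ 1 / 2 ^ n := by
            rw [Real.dist_eq, abs_sub_le_iff]; constructor <;> linarith
          gcongr
      _ = _ := by simp
  · rw [Real.sqrt_mul (Nat.cast_nonneg _), Real.sqrt_sq hδ]

theorem isPreconnected_dyadicCube (d n : ℕ) (k : Fin d → ℤ) :
    IsPreconnected (dyadicCube d n k) := by
  refine Convex.isPreconnected ?_
  intro x hx y hy a b ha hb hab j
  have := (convex_Ico ((k j : ℝ) / 2 ^ n) (((k j : ℝ) + 1) / 2 ^ n)) (hx j) (hy j) ha hb hab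
  simpa using this

theorem subset_dyadicHull (d : ℕ) (K : Set (Euc d)) (n : ℕ) : K ⊆ dyadicHull d K n := by
  intro x hx
  exact mem_iUnion₂.2 ⟨_, ⟨x, mem_dyadicCube_floor d n x, hx⟩, mem_dyadicCube_floor d n x⟩

/-- The dyadic hull of a set covered by `m` balls of radius `2⁻ⁿ` has at most `3 ^ d * m`
components. -/
theorem components_dyadicHull_finite {d n : ℕ} {K : Set (Euc d)} {s : Finset (Euc d)}
    (hs : K ⊆ ⋃ x ∈ s, ball x (1 / 2 ^ n)) :
    Finite {C : Set (Euc d) // ∃ x ∈ dyadicHull d K n,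
      C = connectedComponentIn (dyadicHull d K n) x} ∧
    numComponents (dyadicHull d K n) ≤ 3 ^ d * s.card := by
  classical
  set H := dyadicHull d K n with hH
  let T : Finset (Fin d → ℤ) := s.biUnion fun x =>
    Fintype.piFinset fun j => Finset.Icc (⌊2 ^ n * x j⌋ - 1) (⌊2 ^ n * x j⌋ + 1)
  have hTcard : T.card ≤ 3 ^ d * s.card := by
    refine (Finset.card_biUnion_le_card_mul s _ (3 ^ d) fun x _ => ?_).trans_eq (mul_comm _ _)
    rw [Fintype.card_piFinset]
    refine (Finset.prod_le_pow_card _ _ 3 fun j _ => ?_).trans_eq (by simp)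
    rw [Int.card_Icc]; omega
  have hT : ∀ k, (dyadicCube d n k ∩ K).Nonempty → k ∈ T := by
    rintro k ⟨z, hzk, hzK⟩
    have := hs hzK
    simp only [mem_iUnion, exists_prop, mem_ball] at this
    obtain ⟨x, hx, hzx⟩ := this
    refine Finset.mem_biUnion.2 ⟨x, hx, Fintype.mem_piFinset.2 fun j => Finset.mem_Icc.2 ?_⟩
    have h2 : (0 : ℝ) < 2 ^ n := by positivity
    have hj : |2 ^ n * z j - 2 ^ n * x j| < 1 := by
      have h3 : |z j - x j| ≤ dist z x := by
        rw [dist_eq_norm, ← Real.norm_eq_abs]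
        exact PiLp.norm_apply_le (z - x) j
      rw [← mul_sub, abs_mul, abs_of_pos h2]
      rw [lt_div_iff₀' h2] at hzx
      exact (mul_le_mul_of_nonneg_left h3 h2.le).trans_lt hzx
    rw [eq_floor_of_mem_dyadicCube hzk j]
    rw [abs_sub_lt_iff] at hj
    have a1 := Int.floor_le ((2 : ℝ) ^ n * z j)
    have a2 := Int.lt_floor_add_one ((2 : ℝ) ^ n * z j)
    have b1 := Int.floor_le ((2 : ℝ) ^ n * x j)
    have b2 := Int.lt_floor_add_one ((2 : ℝ) ^ n * x j)
    have c1 : ⌊(2 : ℝ) ^ n * x j⌋ < ⌊(2 : ℝ) ^ n * z j⌋ + 2 := by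
      have : ((⌊(2 : ℝ) ^ n * x j⌋ : ℤ) : ℝ) < (⌊(2 : ℝ) ^ n * z j⌋ : ℤ) + 2 := by linarith
      exact_mod_cast this
    have c2 : ⌊(2 : ℝ) ^ n * z j⌋ < ⌊(2 : ℝ) ^ n * x j⌋ + 2 := by
      have : ((⌊(2 : ℝ) ^ n * z j⌋ : ℤ) : ℝ) < (⌊(2 : ℝ) ^ n * x j⌋ : ℤ) + 2 := by linarith
      exact_mod_cast this
    omega
  let 𝒞 : Set (Set (Euc d)) := {C | ∃ x ∈ H, C = connectedComponentIn H x}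
  let g : (Fin d → ℤ) → Set (Euc d) := fun k =>
    connectedComponentIn H (WithLp.toLp 2 fun j => (k j : ℝ) / 2 ^ n)
  have hsub : 𝒞 ⊆ g '' T := by
    rintro _ ⟨x, hx, rfl⟩
    obtain ⟨k, hk, hxk⟩ := mem_iUnion₂.1 hx
    refine ⟨k, hT k hk, connectedComponentIn_eq ?_⟩
    have hcorner : (WithLp.toLp 2 fun j => (k j : ℝ) / 2 ^ n) ∈ dyadicCube d n k := by
      intro j
      exact ⟨le_rfl, div_lt_div_of_pos_right (lt_add_one _) (by positivity)⟩
    have hcube : dyadicCube d n k ⊆ H := fun w hw => mem_iUnion₂.2 ⟨k, hk, hw⟩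
    exact (isPreconnected_dyadicCube d n k).subset_connectedComponentIn hcorner hcube hxk
  have hfin : (g '' (T : Set (Fin d → ℤ))).Finite := T.finite_toSet.image g
  refine ⟨(hfin.subset hsub).to_subtype, ?_⟩
  change Nat.card 𝒞 ≤ _
  rw [Nat.card_coe_set_eq]
  refine (Set.ncard_le_ncard hsub hfin).trans ((Set.ncard_image_le T.finite_toSet).trans ?_)
  rwa [Set.ncard_coe_finset]

theorem IsSeparatedSelfSimilar.tendsto_log_numComponents {d N : ℕ} {S : Fin N → Euc d → Euc d}
    {r : Fin N → ℝ} {K : Set (Euc d)} (h : IsSeparatedSelfSimilar S r K) {β : ℝ} (hβ0 : 0 < β)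
    (hβ : ∑ i, r i ^ β = 1) :
    Tendsto (fun n : ℕ => Real.log (numComponents (dyadicHull d K n) : ℝ) / (n * Real.log 2))
      atTop (𝓝 β) := by
  obtain ⟨C, hC, hcov⟩ := h.exists_finset_cover hβ0 hβ
  obtain ⟨f, ε, hε, hf, hsep, -⟩ := h.exists_surjective_holder hβ0 hβ
  have hδ : ∀ n : ℕ, (0 : ℝ) < 1 / 2 ^ n ∧ (1 : ℝ) / 2 ^ n ≤ C := fun n =>
    ⟨by positivity, ((div_le_one (by positivity)).2 (one_le_pow₀ (by norm_num))).trans hC⟩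
  have hlog : ∀ n : ℕ, -Real.log (1 / 2 ^ n) = n * Real.log 2 := fun n => by simp
  have hlow : ∀ n : ℕ, 1 ≤ (numComponents (dyadicHull d K n) : ℝ) *
      (2 * (√d + 1) / ε * (1 / 2 ^ n)) ^ β := by
    intro n
    obtain ⟨s, -, hs⟩ := hcov _ (hδ n).1 (hδ n).2
    have hfin := (components_dyadicHull_finite hs).1
    have := Fintype.ofFinite {C : Set (Euc d) // ∃ x ∈ dyadicHull d K n,
      C = connectedComponentIn (dyadicHull d K n) x}
    rw [numComponents, Nat.card_eq_fintype_card]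
    refine one_le_card_mul_of_oscillation hf (V := fun D => D.1) (fun x hx => ?_) ?_
    · have hxH := subset_dyadicHull d K n hx
      exact mem_iUnion.2 ⟨⟨_, x, hxH, rfl⟩, mem_connectedComponentIn hxH⟩
    · rintro ⟨_, z, hz, rfl⟩ x ⟨hxz, hxK⟩ y ⟨hyz, hyK⟩
      by_cases hxy : x = y
      · subst hxy; rw [sub_self, abs_zero]; positivity
      obtain ⟨A, hAK, hxA, hyA, ρ, hρ, hosc, hgap⟩ := hsep x hxK y hyK hxy
      refine hosc.trans (Real.rpow_le_rpow hρ.le ?_ hβ0.le)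
      have hH : ∀ z ∈ dyadicHull d K n, ∃ w ∈ K, dist z w ≤ √d * (1 / 2 ^ n) := by
        intro z hz
        obtain ⟨k, ⟨w, hwk, hwK⟩, hzk⟩ := mem_iUnion₂.1 hz
        exact ⟨w, hwK, dist_le_of_mem_dyadicCube hzk hwk⟩
      have hle := gap_le_of_mem_connectedComponentIn hH hgap hxA ⟨hyK, hyA⟩ (by positivity)
        hxz hyz
      have hpos := (hδ n).1
      calc ρ ≤ 2 * (√d * (1 / 2 ^ n)) / ε := by rwa [le_div_iff₀' hε]
        _ ≤ 2 * ((√d + 1) * (1 / 2 ^ n)) / ε := by gcongr; linarith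
        _ = _ := by ring
  refine tendsto_div_of_affine_bounds
    (tendsto_natCast_atTop_atTop.atTop_mul_const (Real.log_pos one_lt_two))
    (c₁ := -(β * Real.log (2 * (√d + 1) / ε))) (c₂ := Real.log (3 ^ d) + β * Real.log C)
    (Eventually.of_forall fun n => ?_) (Eventually.of_forall fun n => ?_)
  · rw [← hlog]
    exact log_lower_bound (Nat.cast_nonneg _) (by positivity) (hδ n).1 (hlow n)
  · rw [← hlog]
    obtain ⟨s, hcard, hs⟩ := hcov _ (hδ n).1 (hδ n).2
    have hle := (components_dyadicHull_finite hs).2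
    refine log_upper_bound ?_ (by positivity) (by linarith) (hδ n).1 ?_
    · rcases (Nat.cast_nonneg (α := ℝ) (numComponents (dyadicHull d K n))).lt_or_eq with h0 | h0
      · exact h0
      · have := hlow n
        rw [← h0] at this; linarith
    · have : (numComponents (dyadicHull d K n) : ℝ) ≤ 3 ^ d * s.card := by exact_mod_cast hle
      exact this.trans (by gcongr)

/-- For a self-similar compact set satisfying the strong separation condition, the box
separation index coincides with the Hausdorff dimension and the lower and upper box
dimensions, all equal to the similarity dimension `β`. -/
theorem bsi_self_similar (d N : ℕ) (hN : 2 ≤ N)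
    (S : Fin N → Euc d → Euc d) (r : Fin N → ℝ)
    (hr : ∀ i, r i ∈ Set.Ioo (0:ℝ) 1)
    (hS : ∀ i, ∀ x y : Euc d, dist (S i x) (S i y) = r i * dist x y)
    (K : Set (Euc d)) (hK : IsCompact K) (hKne : K.Nonempty)
    (hself : K = ⋃ i, S i '' K)
    (hsep : ∀ i j, i ≠ j → Disjoint (S i '' K) (S j '' K))
    (β : ℝ) (hβ : ∑ i, r i ^ β = 1) :
    bsi d K = β ∧ dimH K = ENNReal.ofReal β ∧
      lowerBoxDim K = (β : EReal) ∧ upperBoxDim K = (β : EReal) := by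
  have h : IsSeparatedSelfSimilar S r K := ⟨hr, hS, hK, hKne, hself, hsep⟩
  have hβ0 : 0 < β := exponent_pos hN hr hβ
  have hbox := (continuous_coe_real_ereal.tendsto β).comp (h.tendsto_log_coveringNumber hβ0 hβ)
  exact ⟨(h.tendsto_log_numComponents hβ0 hβ).liminf_eq, h.dimH_eq hβ0 hβ, hbox.liminf_eq,
    hbox.limsup_eq⟩

end
end
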